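/- (Brown–Erdős–Sós conjecture for groups.) For every integer k ≥ 3 and every real c > 0, there exists n₀ ∈ ℕ such that for every finite group Γ with |Γ| ≥ n₀ and every set S ⊆ Γ × Γ with |S| ≥ c·|Γ|², there exists a subset T ⊆ Γ with |T| ≤ k + 3 such that the number of pairs (a,b) ∈ S with a ∈ T, b ∈ T and a·b ∈ T is at least k. -/

import Mathlib

/-- The number of pairs `(a,b) ∈ S` spanned by `T`, i.e. with `a ∈ T`, `b ∈ T`, `a * b ∈ T`. -/
def spannedCount {Γ : Type} [Group Γ] [DecidableEq Γ] (S : Finset (Γ × Γ)) (T : Finset Γ) : ℕ :=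
  (S.filter (fun p => p.1 ∈ T ∧ p.2 ∈ T ∧ p.1 * p.2 ∈ T)).card

open Combinatorics

section Averages

variable {X Y : Type*}

/-- The real indicator of a proposition. -/
noncomputable def ind (p : Prop) : ℝ := by
  classical exact if p then 1 else 0

lemma ind_of_true {p : Prop} (h : p) : ind p = 1 := by simp [ind, h]

lemma ind_of_false {p : Prop} (h : ¬p) : ind p = 0 := by simp [ind, h]

lemma ind_nonneg (p : Prop) : 0 ≤ ind p := by
  by_cases h : p <;> simp [ind, h]

lemma ind_le_one (p : Prop) : ind p ≤ 1 := by
  by_cases h : p <;> simp [ind, h]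

lemma ind_mono {p q : Prop} (h : p → q) : ind p ≤ ind q := by
  by_cases hp : p
  · simp [ind, hp, h hp]
  · simpa [ind, hp] using ind_nonneg q

/-- The average of a real function over a finite type (zero if the type is empty). -/
noncomputable def avg [Finite X] (f : X → ℝ) : ℝ := (∑ᶠ x, f x) / Nat.card X

lemma avg_eq [Fintype X] (f : X → ℝ) : avg f = (∑ x, f x) / Fintype.card X := by
  rw [avg, finsum_eq_sum_of_fintype, Nat.card_eq_fintype_card]

variable [Finite X] [Finite Y]

lemma avg_add (f g : X → ℝ) : avg (fun x => f x + g x) = avg f + avg g := by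
  cases nonempty_fintype X
  simp [avg_eq, Finset.sum_add_distrib, add_div]

lemma avg_sub (f g : X → ℝ) : avg (fun x => f x - g x) = avg f - avg g := by
  cases nonempty_fintype X
  simp [avg_eq, Finset.sum_sub_distrib, sub_div]

lemma avg_const_mul (c : ℝ) (f : X → ℝ) : avg (fun x => c * f x) = c * avg f := by
  cases nonempty_fintype X
  simp [avg_eq, ← Finset.mul_sum, mul_div_assoc]

lemma avg_const [Nonempty X] (c : ℝ) : avg (fun _ : X => c) = c := by
  cases nonempty_fintype X
  simp [avg_eq]

lemma avg_mono {f g : X → ℝ} (h : ∀ x, f x ≤ g x) : avg f ≤ avg g := by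
  cases nonempty_fintype X
  rw [avg_eq, avg_eq]
  gcongr
  exact h _

lemma avg_nonneg {f : X → ℝ} (h : ∀ x, 0 ≤ f x) : 0 ≤ avg f := by
  cases nonempty_fintype X
  rw [avg_eq]
  exact div_nonneg (Finset.sum_nonneg fun x _ => h x) (Nat.cast_nonneg _)

lemma avg_of_isEmpty [IsEmpty X] (f : X → ℝ) : avg f = 0 := by
  simp [avg]

lemma nonempty_of_avg_pos {f : X → ℝ} (h : 0 < avg f) : Nonempty X := by
  by_contra hX
  rw [not_nonempty_iff] at hX
  simp [avg_of_isEmpty] at h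

lemma avg_le_const {f : X → ℝ} {c : ℝ} (hc : 0 ≤ c) (h : ∀ x, f x ≤ c) : avg f ≤ c := by
  rcases isEmpty_or_nonempty X with hX | hX
  · rwa [avg_of_isEmpty]
  · exact (avg_mono h).trans (avg_const c).le

lemma exists_avg_le [Nonempty X] (f : X → ℝ) : ∃ x, avg f ≤ f x := by
  by_contra! h
  obtain ⟨m, hm⟩ := Finite.exists_max f
  have := avg_mono hm
  rw [avg_const] at this
  exact absurd (h m) (not_lt.mpr this)

lemma exists_avg_le_avg [Nonempty X] {f g : X → ℝ} (h : avg f ≤ avg g) : ∃ x, f x ≤ g x := by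
  obtain ⟨x, hx⟩ := exists_avg_le fun x => g x - f x
  exact ⟨x, by rw [avg_sub] at hx; linarith⟩

lemma avg_sum {J : Type*} (s : Finset J) (f : J → X → ℝ) :
    avg (fun x => ∑ j ∈ s, f j x) = ∑ j ∈ s, avg (f j) := by
  cases nonempty_fintype X
  simp only [avg_eq]
  rw [Finset.sum_comm, Finset.sum_div]

lemma avg_comm (f : X → Y → ℝ) :
    avg (fun x => avg fun y => f x y) = avg (fun y => avg fun x => f x y) := by
  cases nonempty_fintype X
  cases nonempty_fintype Y
  simp only [avg_eq]
  rw [← Finset.sum_div, ← Finset.sum_div, Finset.sum_comm, div_right_comm]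

lemma avg_equiv (e : X ≃ Y) (f : Y → ℝ) : avg (fun x => f (e x)) = avg f := by
  cases nonempty_fintype X
  cases nonempty_fintype Y
  rw [avg_eq, avg_eq, Equiv.sum_comp e f, Fintype.card_congr e]

lemma avg_prod (f : X × Y → ℝ) : avg f = avg fun x => avg fun y => f (x, y) := by
  cases nonempty_fintype X
  cases nonempty_fintype Y
  simp only [avg_eq]
  rw [← Finset.sum_div, Fintype.sum_prod_type, Fintype.card_prod, div_div]
  push_cast
  rw [mul_comm]

lemma avg_sum_arrow {ι κ β : Type*} [Finite ι] [Finite κ] [Finite β] (f : (ι ⊕ κ → β) → ℝ) :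
    avg f = avg fun y : ι → β => avg fun z : κ → β => f (Sum.elim y z) := by
  rw [← avg_equiv (Equiv.sumArrowEquivProdArrow ι κ β).symm f, avg_prod]
  rfl

lemma avg_sum_arrow' {ι κ β : Type*} [Finite ι] [Finite κ] [Finite β] (f : (ι ⊕ κ → β) → ℝ) :
    avg f = avg fun z : κ → β => avg fun y : ι → β => f (Sum.elim y z) := by
  rw [avg_sum_arrow, avg_comm]

lemma avg_ind_eq (x₀ : X) : avg (fun x => ind (x = x₀)) = 1 / Nat.card X := by
  classical
  cases nonempty_fintype X
  rw [avg_eq, Nat.card_eq_fintype_card]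
  simp [ind]

lemma avg_ind_le_one (p : X → Prop) : avg (fun x => ind (p x)) ≤ 1 :=
  avg_le_const zero_le_one fun x => ind_le_one (p x)

lemma avg_ind_nonneg (p : X → Prop) : 0 ≤ avg (fun x => ind (p x)) :=
  avg_nonneg fun x => ind_nonneg (p x)

/-- A function bounded by one with average at least `δ` is at least `δ / 2` on a set of density at
least `δ / 2`. -/
lemma half_le_avg_ind {f : X → ℝ} {δ : ℝ} (hδ : 0 < δ) (hf : ∀ x, f x ≤ 1) (h : δ ≤ avg f) :
    δ / 2 ≤ avg fun x => ind (δ / 2 ≤ f x) := by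
  have : Nonempty X := nonempty_of_avg_pos (hδ.trans_le h)
  have h1 : avg f ≤ avg fun x => ind (δ / 2 ≤ f x) + δ / 2 := avg_mono fun x => by
    by_cases hx : δ / 2 ≤ f x
    · rw [ind_of_true hx]; linarith [hf x]
    · rw [ind_of_false hx]; linarith
  rw [avg_add, avg_const] at h1
  linarith

/-- Pigeonhole: if every point of a set of density at least `a` has some witness among finitely
many, then some witness serves a set of proportional density. -/
lemma exists_witness {J : Type*} [Finite J] {a : ℝ} (ha : 0 < a) {p : X → Prop} {q : J → X → Prop}
    (hpq : ∀ x, p x → ∃ j, q j x) (h : a ≤ avg fun x => ind (p x)) :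
    ∃ j, a / (Nat.card J + 1) ≤ avg fun x => ind (q j x) := by
  cases nonempty_fintype J
  by_contra! hcon
  have h1 : avg (fun x => ind (p x)) ≤ avg fun x => ∑ j, ind (q j x) := avg_mono fun x => by
    by_cases hx : p x
    · obtain ⟨j, hj⟩ := hpq x hx
      rw [ind_of_true hx, ← ind_of_true hj]
      exact Finset.single_le_sum (f := fun j => ind (q j x)) (fun j _ => ind_nonneg _)
        (Finset.mem_univ j)
    · rw [ind_of_false hx]
      exact Finset.sum_nonneg fun j _ => ind_nonneg _
  rw [avg_sum] at h1
  have h2 : ∑ j, avg (fun x => ind (q j x)) ≤ ∑ _j : J, a / (Nat.card J + 1) :=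
    Finset.sum_le_sum fun j _ => (hcon j).le
  rw [Finset.sum_const, Finset.card_univ, nsmul_eq_mul, Nat.card_eq_fintype_card] at h2
  have h3 : (Fintype.card J : ℝ) * (a / (Fintype.card J + 1)) < a := by
    rw [mul_div_assoc', div_lt_iff₀ (by positivity)]
    nlinarith
  linarith

/-- The average over the range of an injection. -/
lemma avg_mul_ind_range {φ : Y → X} (hφ : Function.Injective φ) (f : X → ℝ) :
    avg (fun x => f x * ind (x ∈ Set.range φ)) =
      Nat.card Y / Nat.card X * avg fun y => f (φ y) := by
  classical
  cases nonempty_fintype X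
  cases nonempty_fintype Y
  rcases isEmpty_or_nonempty Y with hY | hY
  · simp [avg_eq, ind]
  have : ∑ x, f x * ind (x ∈ Set.range φ) = ∑ y, f (φ y) := by
    rw [← Finset.sum_image (s := Finset.univ) (f := f) (g := φ) (fun a _ b _ h => hφ h),
      ← Finset.sum_subset (Finset.subset_univ (Finset.univ.image φ))]
    · refine Finset.sum_congr rfl fun x hx => ?_
      rw [ind_of_true (by simpa using hx), mul_one]
    · intro x _ hx
      rw [ind_of_false (by simpa using hx), mul_zero]
  rw [avg_eq, avg_eq, this, Nat.card_eq_fintype_card, Nat.card_eq_fintype_card]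
  have : (Fintype.card Y : ℝ) ≠ 0 := by simp
  field_simp

end Averages

section Subspaces

variable {α β η κ ι ρ : Type*}

namespace Combinatorics.Subspace

/-- Composition of combinatorial subspaces. -/
def comp (V : Subspace κ β ι) (U : Subspace η β κ) : Subspace η β ι where
  idxFun i := (V.idxFun i).elim Sum.inl U.idxFun
  proper e := by
    obtain ⟨j, hj⟩ := U.proper e
    obtain ⟨i, hi⟩ := V.proper j
    exact ⟨i, by simp [hi, hj]⟩

@[simp] lemma comp_apply (V : Subspace κ β ι) (U : Subspace η β κ) (x : η → β) :
    V.comp U x = V (U x) := by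
  ext i
  cases h : V.idxFun i <;> simp [Subspace.coe_apply, comp, h]

/-- The points of a line inside a combinatorial subspace form a line. -/
def compLine (V : Subspace η β ι) (L : Line β η) : Line β ι where
  idxFun i := (V.idxFun i).elim some L.idxFun
  proper := by
    obtain ⟨j, hj⟩ := L.proper
    obtain ⟨i, hi⟩ := V.proper j
    exact ⟨i, by simp [hi, hj]⟩

@[simp] lemma compLine_apply (V : Subspace η β ι) (L : Line β η) (b : β) :
    V.compLine L b = V (L b) := by
  ext i
  cases h : V.idxFun i <;> simp [Subspace.coe_apply, compLine, h]

/-- The image of a combinatorial subspace under a map of alphabets. -/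
def mapLetters (g : α → β) (V : Subspace η α ι) : Subspace η β ι where
  idxFun i := (V.idxFun i).map g id
  proper e := by
    obtain ⟨i, hi⟩ := V.proper e
    exact ⟨i, by simp [hi]⟩

lemma mapLetters_comp (g : α → β) (V : Subspace η α ι) (x : η → α) :
    V.mapLetters g (g ∘ x) = g ∘ V x := by
  ext i
  cases h : V.idxFun i <;> simp [Subspace.coe_apply, mapLetters, h]

/-- The subspace `V × {w}`. -/
def prodConst (V : Subspace η β ι) (w : κ → β) : Subspace η β (ι ⊕ κ) where
  idxFun := Sum.elim V.idxFun fun j => Sum.inl (w j)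
  proper e := by
    obtain ⟨i, hi⟩ := V.proper e
    exact ⟨Sum.inl i, hi⟩

@[simp] lemma prodConst_apply (V : Subspace η β ι) (w : κ → β) (x : η → β) :
    V.prodConst w x = Sum.elim (V x) w := by
  ext (i | i) <;> simp [Subspace.coe_apply, prodConst]

/-- The subspace `{w} × V`. -/
def constProd (w : κ → β) (V : Subspace η β ι) : Subspace η β (κ ⊕ ι) where
  idxFun := Sum.elim (fun j => Sum.inl (w j)) V.idxFun
  proper e := by
    obtain ⟨i, hi⟩ := V.proper e
    exact ⟨Sum.inr i, hi⟩

@[simp] lemma constProd_apply (w : κ → β) (V : Subspace η β ι) (x : η → β) :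
    constProd w V x = Sum.elim w (V x) := by
  ext (i | i) <;> simp [Subspace.coe_apply, constProd]

/-- The product of a line and a subspace, with the direction of the line as the direction
`none`. -/
def lineProd (L : Line β κ) (V : Subspace η β ι) : Subspace (Option η) β (κ ⊕ ι) where
  idxFun := Sum.elim (fun j => (L.idxFun j).elim (Sum.inr none) Sum.inl)
    fun i => (V.idxFun i).map id some
  proper e := by
    cases e with
    | none =>
      obtain ⟨j, hj⟩ := L.proper
      exact ⟨Sum.inl j, by simp [hj]⟩
    | some e =>
      obtain ⟨i, hi⟩ := V.proper e
      exact ⟨Sum.inr i, by simp [hi]⟩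

@[simp] lemma lineProd_apply (L : Line β κ) (V : Subspace η β ι) (x : Option η → β) :
    lineProd L V x = Sum.elim (L (x none)) (V fun e => x (some e)) := by
  ext (i | i)
  · cases h : L.idxFun i <;> simp [Subspace.coe_apply, lineProd, h]
  · cases h : V.idxFun i <;> simp [Subspace.coe_apply, lineProd, h]

lemma apply_injective (V : Subspace η β ι) : Function.Injective fun x : η → β => V x := by
  intro x y h
  ext e
  obtain ⟨i, hi⟩ := V.proper e
  have := congrFun h i
  simpa [Subspace.coe_apply, hi] using this

/-- The whole cube as a combinatorial subspace of itself. -/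
def refl (β ι : Type*) : Subspace ι β ι := ⟨Sum.inr, fun i => ⟨i, rfl⟩⟩

@[simp] lemma refl_apply (x : ι → β) : refl β ι x = x := rfl

instance [Finite η] [Finite β] [Finite ι] : Finite (Subspace η β ι) :=
  Finite.of_injective idxFun fun _ _ h => Subspace.ext h

end Combinatorics.Subspace

instance [Finite β] [Finite ι] : Finite (Line β ι) :=
  Finite.of_injective Line.idxFun fun _ _ h => Line.ext h

end Subspaces

section DensityHalesJewett

variable {α β η κ ι ρ : Type}

/-- The density Hales–Jewett property for the alphabet `β`. -/
def DensityHJ (β : Type) [Finite β] : Prop :=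
  ∀ δ : ℝ, 0 < δ → ∃ (ι : Type) (_ : Finite ι), ∀ P : (ι → β) → Prop,
    δ ≤ avg (fun x => ind (P x)) → ∃ L : Line β ι, ∀ b, P (L b)

/-- The multidimensional density Hales–Jewett property follows from the one-dimensional one. -/
lemma DensityHJ.multidim [Finite β] (h : DensityHJ β) (η : Type) [Finite η] :
    ∀ δ : ℝ, 0 < δ → ∃ (ι : Type) (_ : Finite ι), ∀ P : (ι → β) → Prop,
      δ ≤ avg (fun x => ind (P x)) → ∃ V : Subspace η β ι, ∀ x, P (V x) := by
  induction η using Finite.induction_empty_option with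
  | of_equiv e ih =>
    intro δ hδ
    obtain ⟨ι, hι, H⟩ := ih δ hδ
    refine ⟨ι, hι, fun P hP => ?_⟩
    obtain ⟨V, hV⟩ := H P hP
    refine ⟨V.reindex e (Equiv.refl _) (Equiv.refl _), fun x => ?_⟩
    have : V.reindex e (Equiv.refl _) (Equiv.refl _) x = V (x ∘ e) := by
      ext i
      simp
    rw [this]
    exact hV _
  | h_empty =>
    intro δ hδ
    refine ⟨PEmpty, inferInstance, fun P hP => ?_⟩
    refine ⟨⟨PEmpty.elim, fun e => e.elim⟩, fun x => ?_⟩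
    by_contra hx
    have : ∀ y, ¬P y := fun y => by rwa [Subsingleton.elim y]
    have h0 := avg_le_const (f := fun x => ind (P x)) le_rfl fun y => (ind_of_false (this y)).le
    linarith
  | h_option ih =>
    intro δ hδ
    obtain ⟨κ, hκ, Hκ⟩ := h (δ / 2) (by linarith)
    obtain ⟨ι, hι, Hι⟩ := ih (δ / 2 / (Nat.card (Line β κ) + 1)) (by positivity)
    refine ⟨κ ⊕ ι, inferInstance, fun P hP => ?_⟩
    rw [avg_sum_arrow'] at hP
    have h1 := half_le_avg_ind hδ (fun z => avg_ind_le_one _) hP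
    obtain ⟨L, hL⟩ := exists_witness (J := Line β κ)
      (q := fun L z => ∀ b, P (Sum.elim (L b) z)) (by linarith)
      (fun z hz => Hκ (fun y => P (Sum.elim y z)) hz) h1
    obtain ⟨V, hV⟩ := Hι _ hL
    exact ⟨Subspace.lineProd L V, fun x => by rw [Subspace.lineProd_apply]; exact hV _ _⟩

/-- Every dense set has, after restricting to a suitable subspace, all its sections over a
prescribed block of coordinates almost as dense as the whole set. -/
lemma exists_uniform_sections [Finite β] [Nonempty β] (κ : Type) [Finite κ] {ν : ℝ} (hν : 0 < ν) :
    ∃ (ι : Type) (_ : Finite ι), ∀ (P : (ι → β) → Prop) (δ : ℝ), 0 ≤ δ →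
      δ ≤ avg (fun x => ind (P x)) → ∃ (ρ : Type) (_ : Finite ρ) (V : Subspace (κ ⊕ ρ) β ι),
        ∀ z : κ → β, δ - ν ≤ avg fun w : ρ → β => ind (P (V (Sum.elim z w))) := by
  set N : ℝ := ((Nat.card (κ → β) : ℕ) : ℝ) with hN
  have hNpos : 0 < N := by
    rw [hN]
    exact_mod_cast Nat.card_pos
  have key : ∀ t : ℕ, ∃ (ι : Type) (_ : Finite ι), ∀ (P : (ι → β) → Prop) (δ : ℝ),
      1 - t * (ν / N) < δ →
      δ ≤ avg (fun x => ind (P x)) → ∃ (ρ : Type) (_ : Finite ρ) (V : Subspace (κ ⊕ ρ) β ι),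
        ∀ z : κ → β, δ - ν ≤ avg fun w : ρ → β => ind (P (V (Sum.elim z w))) := by
    intro t
    induction t with
    | zero =>
      refine ⟨PEmpty, inferInstance, fun P δ h1 h2 => ?_⟩
      have := avg_ind_le_one P
      simp only [CharP.cast_eq_zero, zero_mul, sub_zero] at h1
      linarith
    | succ t ih =>
      obtain ⟨ι, hι, H⟩ := ih
      refine ⟨κ ⊕ ι, inferInstance, fun P δ h1 h2 => ?_⟩
      by_cases hall : ∀ z : κ → β, δ - ν ≤ avg fun w : ι → β => ind (P (Sum.elim z w))
      · exact ⟨ι, hι, Subspace.refl _ _, hall⟩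
      push Not at hall
      obtain ⟨z₀, hz₀⟩ := hall
      have hz : ∃ z : κ → β, δ + ν / N ≤ avg fun w : ι → β => ind (P (Sum.elim z w)) := by
        by_contra! hcon
        rw [avg_sum_arrow] at h2
        have h3 := avg_mono (f := fun z : κ → β => avg fun w : ι → β => ind (P (Sum.elim z w)))
          (g := fun z => δ + ν / N - (ν + ν / N) * ind (z = z₀)) fun z => by
            by_cases hzz : z = z₀
            · rw [ind_of_true hzz, hzz]; linarith
            · rw [ind_of_false hzz]; linarith [hcon z]
        rw [avg_sub, avg_const, avg_const_mul, avg_ind_eq, ← hN] at h3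
        have h4 : (ν + ν / N) * (1 / N) = ν / N + ν / N / N := by field_simp
        have h5 : 0 < ν / N / N := by positivity
        linarith
      obtain ⟨z, hz⟩ := hz
      have hη : 0 < ν / N := by positivity
      obtain ⟨ρ, hρ, V, hV⟩ := H (fun w => P (Sum.elim z w)) (δ + ν / N)
        (by push_cast at h1; linarith) hz
      refine ⟨ρ, hρ, Subspace.constProd z V, fun y => ?_⟩
      simp only [Subspace.constProd_apply]
      linarith [hV y]
  obtain ⟨t, ht⟩ := exists_nat_gt (1 / (ν / N))
  obtain ⟨ι, hι, H⟩ := key t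
  refine ⟨ι, hι, fun P δ h0 h1 => H P δ ?_ h1⟩
  rw [div_lt_iff₀ (by positivity)] at ht
  linarith

/-- Two words are equivalent if they agree up to exchanging the letters `none` and `some a`. -/
def ExchangeRel (a : α) (x y : ι → Option α) : Prop :=
  ∀ i, x i = y i ∨ ((x i = none ∨ x i = some a) ∧ (y i = none ∨ y i = some a))

/-- A set of words is insensitive if it does not distinguish the letters `none` and `some a`. -/
def Insensitive (a : α) (D : (ι → Option α) → Prop) : Prop :=
  ∀ x y, ExchangeRel a x y → (D x ↔ D y)

lemma ExchangeRel.subspace {a : α} {x y : η → Option α} (h : ExchangeRel a x y)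
    (V : Subspace η (Option α) ι) : ExchangeRel a (V x) (V y) := by
  intro i
  cases hi : V.idxFun i with
  | inl b => simp [Subspace.coe_apply, hi]
  | inr e => simpa [Subspace.coe_apply, hi] using h e

lemma Insensitive.comp_subspace {a : α} {D : (ι → Option α) → Prop} (h : Insensitive a D)
    (V : Subspace η (Option α) ι) : Insensitive a fun x => D (V x) :=
  fun _ _ hxy => h _ _ (hxy.subspace V)

lemma ExchangeRel.elim_left {a : α} {x y : ι → Option α} (h : ExchangeRel a x y)
    (w : κ → Option α) : ExchangeRel a (Sum.elim x w) (Sum.elim y w) := by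
  rintro (i | i)
  · exact h i
  · exact Or.inl rfl

lemma ExchangeRel.elim_right {a : α} {x y : ι → Option α} (h : ExchangeRel a x y)
    (w : κ → Option α) : ExchangeRel a (Sum.elim w x) (Sum.elim w y) := by
  rintro (i | i)
  · exact Or.inl rfl
  · exact h i

lemma Insensitive.not {a : α} {D : (ι → Option α) → Prop} (h : Insensitive a D) :
    Insensitive a fun x => ¬D x :=
  fun x y hxy => not_congr (h x y hxy)

lemma Insensitive.true (a : α) : Insensitive (ι := ι) a fun _ => True :=
  fun _ _ _ => Iff.rfl

/-- A dense insensitive set contains large subspaces. -/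
lemma DensityHJ.exists_subspace_of_insensitive [Finite α] (h : DensityHJ α) (a : α) (η : Type)
    [Finite η] {ε : ℝ} (hε : 0 < ε) :
    ∃ (ι : Type) (_ : Finite ι), ∀ D : (ι → Option α) → Prop, Insensitive a D →
      ε ≤ avg (fun x => ind (D x)) → ∃ V : Subspace η (Option α) ι, ∀ x, D (V x) := by
  have : Nonempty α := ⟨a⟩
  obtain ⟨κ, hκ, Hκ⟩ := h.multidim η (ε / 2) (by linarith)
  obtain ⟨ι, hι, Hι⟩ := exists_uniform_sections (β := Option α) κ (ν := ε / 2) (by linarith)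
  refine ⟨ι, hι, fun D hD hdens => ?_⟩
  obtain ⟨ρ, hρ, V, hV⟩ := Hι D ε hε.le hdens
  have h1 := avg_mono (f := fun _ : κ → α => ε / 2) (g := fun z =>
    avg fun w : ρ → Option α => ind (D (V (Sum.elim (some ∘ z) w))))
    fun z => by linarith [hV (some ∘ z)]
  rw [avg_const, avg_comm] at h1
  obtain ⟨w, hw⟩ := exists_avg_le fun w : ρ → Option α =>
    avg fun z : κ → α => ind (D (V (Sum.elim (some ∘ z) w)))
  obtain ⟨U, hU⟩ := Hκ _ (h1.trans hw)
  refine ⟨V.comp ((U.mapLetters some).prodConst w), fun x => ?_⟩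
  rw [Subspace.comp_apply, Subspace.prodConst_apply]
  have h2 : ExchangeRel a x (some ∘ fun i => (x i).getD a) := by
    intro i
    cases hx : x i <;> simp [hx]
  rw [hD _ _ (((h2.subspace (U.mapLetters some)).elim_left w).subspace V),
    Subspace.mapLetters_comp]
  exact hU _

lemma avg_mul_ind_le {X : Type*} [Finite X] {f : X → ℝ} (hf : ∀ x, f x ≤ 1) (p : X → Prop) :
    avg (fun x => f x * ind (p x)) ≤ avg fun x => ind (p x) :=
  avg_mono fun x => mul_le_of_le_one_left (ind_nonneg _) (hf x)

lemma ind_and (p q : Prop) : ind (p ∧ q) = ind p * ind q := by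
  by_cases hp : p <;> by_cases hq : q <;> simp [ind, hp, hq]

lemma ind_not (p : Prop) : ind (¬p) = 1 - ind p := by
  by_cases hp : p <;> simp [ind, hp]

/-- A function bounded by one that correlates with an insensitive set has positive average on some
large subspace. -/
lemma DensityHJ.exists_avg_pos_of_insensitive [Finite α] (h : DensityHJ α) (a : α) (η : Type)
    [Finite η] {ε : ℝ} (hε : 0 < ε) :
    ∃ (ι : Type) (_ : Finite ι), ∀ D : (ι → Option α) → Prop, Insensitive a D →
      ∀ f : (ι → Option α) → ℝ, (∀ x, f x ≤ 1) → ε ≤ avg (fun x => f x * ind (D x)) →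
        ∃ V : Subspace η (Option α) ι, 0 < avg fun x => f (V x) := by
  by_cases hε1 : 1 < ε
  · refine ⟨PEmpty, inferInstance, fun D _ f hf hD => ?_⟩
    linarith [avg_mul_ind_le hf D, avg_ind_le_one D]
  obtain ⟨κ, hκ, Hκ⟩ := h.exists_subspace_of_insensitive a η (ε := ε / 2 / 2) (by linarith)
  set c₀ : ℝ := ε / 2 / 2 / (Nat.card (Subspace η (Option α) κ) + 1) with hc₀
  have hc₀pos : 0 < c₀ := by positivity
  set K : ℝ := ((Nat.card (κ → Option α) : ℕ) : ℝ) with hK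
  have hKpos : 1 ≤ K := by
    rw [hK]
    exact_mod_cast Nat.card_pos
  set M : ℝ := ((Nat.card (η → Option α) : ℕ) : ℝ) with hM
  have hMpos : 1 ≤ M := by
    rw [hM]
    exact_mod_cast Nat.card_pos
  set c : ℝ := c₀ / K with hc
  have hcpos : 0 < c := by positivity
  have hc1 : c ≤ 1 := by
    have h1 : c₀ ≤ ε / 2 / 2 := div_le_self (by positivity) (by simp)
    exact (div_le_self hc₀pos.le hKpos).trans (by linarith)
  have key : ∀ t : ℕ, ∃ (ι : Type) (_ : Finite ι), ∀ D : (ι → Option α) → Prop, Insensitive a D →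
      ∀ f : (ι → Option α) → ℝ, (∀ x, f x ≤ 1) →
        ε / 2 + (1 - c) ^ t * avg (fun x => ind (D x)) ≤ avg (fun x => f x * ind (D x)) →
        ∃ V : Subspace η (Option α) ι, 0 < avg fun x => f (V x) := by
    intro t
    induction t with
    | zero =>
      refine ⟨PEmpty, inferInstance, fun D _ f hf hD => ?_⟩
      have := avg_mul_ind_le hf D
      rw [pow_zero, one_mul] at hD
      linarith
    | succ t ih =>
      obtain ⟨ι, hι, H⟩ := ih
      refine ⟨κ ⊕ ι, inferInstance, fun D hD f hf hcor => ?_⟩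
      have hpow : 0 ≤ (1 - c) ^ (t + 1) := pow_nonneg (by linarith) _
      have hdens : ε / 2 ≤ avg fun x => ind (D x) := by
        have := avg_mul_ind_le hf D
        have := mul_nonneg hpow (avg_ind_nonneg D)
        linarith
      have hfib := hdens
      rw [avg_sum_arrow'] at hfib
      obtain ⟨U, hU⟩ := exists_witness (J := Subspace η (Option α) κ)
        (q := fun U y => ∀ x, D (Sum.elim (U x) y)) (by linarith)
        (fun y hy => Hκ (fun z => D (Sum.elim z y)) (fun x x' hx => hD _ _ (hx.elim_left y)) hy)
        (half_le_avg_ind (by linarith) (fun _ => avg_ind_le_one _) hfib)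
      rw [← hc₀] at hU
      set Y : (ι → Option α) → Prop := fun y => ∀ x, D (Sum.elim (U x) y) with hY
      by_cases hpos : ∃ y, Y y ∧ 0 < avg fun x => f (Sum.elim (U x) y)
      · obtain ⟨y, -, hy⟩ := hpos
        exact ⟨U.prodConst y, by simpa only [Subspace.prodConst_apply] using hy⟩
      push Not at hpos
      set R : (κ → Option α) → Prop := fun z => z ∈ Set.range fun x => U x with hR
      have hRD : ∀ z y, R z → Y y → D (Sum.elim z y) := by
        rintro _ y ⟨x, rfl⟩ hy
        exact hy x
      have hsplit : ∀ z y, ind (D (Sum.elim z y) ∧ ¬(R z ∧ Y y)) =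
          ind (D (Sum.elim z y)) - ind (R z) * ind (Y y) := by
        intro z y
        rw [← ind_and]
        by_cases h1 : R z ∧ Y y
        · simp [ind, h1, hRD z y h1.1 h1.2]
        · rw [ind_of_false h1, sub_zero]
          congr 1
          exact propext (and_iff_left h1)
      have hremove : ∀ g : (κ ⊕ ι → Option α) → ℝ,
          avg (fun z => avg fun y => g (Sum.elim z y) * ind (D (Sum.elim z y) ∧ ¬(R z ∧ Y y))) =
            avg (fun x => g x * ind (D x)) -
              M / K * avg fun y => ind (Y y) * avg fun x => g (Sum.elim (U x) y) := by
        intro g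
        rw [avg_sum_arrow fun x => g x * ind (D x), ← avg_const_mul]
        have : ∀ y, M / K * (ind (Y y) * avg fun x => g (Sum.elim (U x) y)) =
            avg fun z => ind (Y y) * (g (Sum.elim z y) * ind (R z)) := by
          intro y
          rw [avg_const_mul, avg_mul_ind_range U.apply_injective fun z => g (Sum.elim z y)]
          ring
        simp only [this]
        rw [avg_comm (fun y z => ind (Y y) * (g (Sum.elim z y) * ind (R z))), ← avg_sub]
        congr 1
        ext z
        rw [← avg_sub]
        congr 1
        ext y
        rw [hsplit]
        ring
      have hf' := hremove f
      have hd' := hremove fun _ => 1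
      simp only [one_mul, avg_const, mul_one] at hd'
      have h1 : avg (fun y => ind (Y y) * avg fun x => f (Sum.elim (U x) y)) ≤ 0 :=
        avg_le_const le_rfl fun y => by
          by_cases hy : Y y
          · rw [ind_of_true hy, one_mul]; exact hpos y hy
          · rw [ind_of_false hy, zero_mul]
      have h2 : c ≤ M / K * avg fun y => ind (Y y) := by
        rw [hc, div_mul_eq_mul_div]
        gcongr
        nlinarith
      have h3 : avg (fun x => ind (D x)) ≤ 1 := avg_ind_le_one D
      have h4 : M / K * avg (fun y => ind (Y y) * avg fun x => f (Sum.elim (U x) y)) ≤ 0 :=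
        mul_nonpos_of_nonneg_of_nonpos (by positivity) h1
      have h5 : avg (fun z => avg fun y => ind (D (Sum.elim z y) ∧ ¬(R z ∧ Y y))) ≤
          (1 - c) * avg (fun x => ind (D x)) := by
        rw [hd']
        nlinarith [avg_ind_nonneg D]
      have h6 : (1 - c) ^ t * avg (fun z => avg fun y => ind (D (Sum.elim z y) ∧ ¬(R z ∧ Y y))) ≤
          (1 - c) ^ (t + 1) * avg (fun x => ind (D x)) := by
        rw [pow_succ, mul_assoc]
        exact mul_le_mul_of_nonneg_left h5 (pow_nonneg (by linarith) _)
      have h7 : avg (fun z : κ → Option α => ε / 2 +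
          (1 - c) ^ t * avg fun y => ind (D (Sum.elim z y) ∧ ¬(R z ∧ Y y))) ≤
          avg fun z => avg fun y => f (Sum.elim z y) * ind (D (Sum.elim z y) ∧ ¬(R z ∧ Y y)) := by
        rw [avg_add, avg_const, avg_const_mul, hf']
        linarith
      obtain ⟨z, hz⟩ := exists_avg_le_avg h7
      obtain ⟨V, hV⟩ := H (fun y => D (Sum.elim z y) ∧ ¬(R z ∧ Y y)) (fun y y' hy =>
        and_congr (hD _ _ (hy.elim_right z)) (not_congr (and_congr Iff.rfl
          (forall_congr' fun x => hD _ _ (hy.elim_right _))))) (fun y => f (Sum.elim z y))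
          (fun y => hf _) hz
      exact ⟨Subspace.constProd z V, by simpa only [Subspace.constProd_apply] using hV⟩
  obtain ⟨t, ht⟩ := exists_pow_lt_of_lt_one (half_pos hε) (show 1 - c < 1 by linarith)
  obtain ⟨ι, hι, H⟩ := key t
  refine ⟨ι, hι, fun D hD f hf hcor => H D hD f hf ?_⟩
  nlinarith [avg_ind_le_one D, avg_ind_nonneg D, pow_nonneg (sub_nonneg.2 hc1) t]

end DensityHalesJewett

section FiniteUnions

variable {ι κ ω ω' : Type}

/-- The union, encoded as an indicator, of the fibres of `J` selected by `y`. -/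
def unionOf (J : ι → Option ω) (y : ω → Bool) : ι → Bool := fun i => (J i).elim false y

/-- There are disjoint nonempty sets indexed by `ω` all of whose nonempty unions lie in `G`. -/
def HasUnions (G : (ι → Bool) → Prop) (ω : Type) : Prop :=
  ∃ J : ι → Option ω, (∀ e, ∃ i, J i = some e) ∧ ∀ y, (∃ e, y e = true) → G (unionOf J y)

lemma HasUnions.of_unionOf {G : (ι → Bool) → Prop} {J : ι → Option κ}
    (hJ : ∀ e, ∃ i, J i = some e) (h : HasUnions (fun y => G (unionOf J y)) ω) :
    HasUnions G ω := by
  obtain ⟨J', hJ', hG⟩ := h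
  refine ⟨fun i => (J i).bind J', fun e => ?_, fun y hy => ?_⟩
  · obtain ⟨j, hj⟩ := hJ' e
    obtain ⟨i, hi⟩ := hJ j
    exact ⟨i, by simp [hi, hj]⟩
  · convert hG y hy using 1
    ext i
    cases h : J i <;> simp [unionOf, h]

lemma HasUnions.of_equiv {G : (ι → Bool) → Prop} (e : ω ≃ ω') (h : HasUnions G ω) :
    HasUnions G ω' := by
  obtain ⟨J, hJ, hG⟩ := h
  refine ⟨fun i => (J i).map e, fun b => ?_, fun y ⟨b, hb⟩ => ?_⟩
  · obtain ⟨i, hi⟩ := hJ (e.symm b)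
    exact ⟨i, by simp [hi]⟩
  · convert hG (y ∘ e) ⟨e.symm b, by simpa using hb⟩ using 1
    ext i
    cases h : J i <;> simp [unionOf, h]

lemma hasUnions_of_isEmpty [IsEmpty ω] (G : (ι → Bool) → Prop) : HasUnions G ω :=
  ⟨fun _ => none, isEmptyElim, fun _ ⟨e, _⟩ => isEmptyElim e⟩

/-- The coordinates of a subspace, with an additional fixed coordinate. -/
def movingPart {β : Type} (U : Subspace κ β ι) (o : Option ι) : Option κ :=
  o.bind fun i => (U.idxFun i).elim (fun _ => none) some

lemma exists_movingPart {β : Type} (U : Subspace κ β ι) (e : κ) : ∃ i, movingPart U i = some e := by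
  obtain ⟨i, hi⟩ := U.proper e
  exact ⟨some i, by simp [movingPart, hi]⟩

lemma HasUnions.option {G : (Option ι → Bool) → Prop} (U : Subspace κ Bool ι)
    (hU : ∀ z, G fun o => o.elim true (U z))
    (h : HasUnions (fun y => G (unionOf (movingPart U) y)) ω) : HasUnions G (Option ω) := by
  obtain ⟨J, hJ, hG⟩ := h
  refine ⟨fun o => o.elim (some none) fun i => (U.idxFun i).elim
    (fun b => if b then some none else none) fun j => (J j).map some, fun e => ?_, fun y hy => ?_⟩
  · cases e with
    | none => exact ⟨none, rfl⟩
    | some e =>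
      obtain ⟨j, hj⟩ := hJ e
      obtain ⟨i, hi⟩ := U.proper j
      exact ⟨some i, by simp [hi, hj]⟩
  · by_cases h0 : y none = true
    · convert hU (unionOf J (y ∘ some)) using 1
      ext o
      rcases o with _ | i
      · simp [unionOf, h0]
      · rcases h : U.idxFun i with b | j
        · cases b <;> simp [unionOf, h, h0, Subspace.coe_apply]
        · cases hj : J j <;> simp [unionOf, h, hj, Subspace.coe_apply]
    · convert hG (y ∘ some) ?_ using 1
      · ext o
        rcases o with _ | i
        · simp [unionOf, h0, movingPart]
        · rcases h : U.idxFun i with b | j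
          · cases b <;> simp [unionOf, h, h0, movingPart]
          · cases hj : J j <;> simp [unionOf, h, hj, movingPart]
      · obtain ⟨e, he⟩ := hy
        cases e with
        | none => exact absurd he h0
        | some e => exact ⟨e, he⟩

/-- Two-colour finite unions theorem. -/
lemma exists_hasUnions (ω₁ ω₂ : Type) [Finite ω₁] [Finite ω₂] :
    ∃ (ι : Type) (_ : Finite ι), ∀ G : (ι → Bool) → Prop,
      HasUnions G ω₁ ∨ HasUnions (fun y => ¬G y) ω₂ := by
  induction ω₁ using Finite.induction_empty_option generalizing ω₂ with
  | of_equiv e ih =>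
    obtain ⟨ι, hι, H⟩ := ih ω₂
    exact ⟨ι, hι, fun G => (H G).imp_left (HasUnions.of_equiv e)⟩
  | h_empty => exact ⟨PEmpty, inferInstance, fun G => Or.inl (hasUnions_of_isEmpty G)⟩
  | h_option ih₁ =>
    rename_i ω₁ _
    induction ω₂ using Finite.induction_empty_option with
    | of_equiv e ih =>
      obtain ⟨ι, hι, H⟩ := ih
      exact ⟨ι, hι, fun G => (H G).imp_right (HasUnions.of_equiv e)⟩
    | h_empty => exact ⟨PEmpty, inferInstance, fun G => Or.inr (hasUnions_of_isEmpty _)⟩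
    | h_option ih₂ =>
      rename_i ω₂ _
      obtain ⟨ι₁, _, H₁⟩ := ih₁ (Option ω₂)
      obtain ⟨ι₂, _, H₂⟩ := ih₂
      obtain ⟨ι, _, H⟩ := Subspace.exists_mono_in_high_dimension Bool Prop (ι₁ ⊕ ι₂)
      refine ⟨Option ι, inferInstance, fun G => ?_⟩
      obtain ⟨U, p, hp⟩ := H fun z => G fun o => o.elim true z
      by_cases hpt : p
      · have hU : ∀ z, G fun o => o.elim true (U z) := fun z => (hp z).mpr hpt
        let U' := U.comp ((Subspace.refl Bool ι₁).prodConst fun _ => false)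
        refine (H₁ fun y => G (unionOf (movingPart U') y)).imp (fun h => h.option U' fun z => ?_)
          fun h => h.of_unionOf (G := fun y => ¬G y) (exists_movingPart U')
        simpa [U'] using hU _
      · have hU : ∀ z, ¬G fun o => o.elim true (U z) := fun z h => hpt ((hp z).mp h)
        let U' := U.comp ((Subspace.refl Bool ι₂).constProd fun _ => false)
        refine (H₂ fun y => G (unionOf (movingPart U') y)).imp
          (fun h => h.of_unionOf (exists_movingPart U'))
          fun h => h.option (G := fun y => ¬G y) U' fun z => ?_
        simpa [U'] using hU _

end FiniteUnions

section GrahamRothschild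

variable {α η ι : Type}

/-- For every finite colouring of words with wildcards there is a subspace on which the colour
depends only on the position of the wildcards. -/
lemma exists_subspace_color_eq [Finite α] [Nonempty α] (η : Type) [Finite η] (K : Type)
    [Finite K] :
    ∃ (ι : Type) (_ : Finite ι), ∀ c : (ι → Option α) → K, ∃ V : Subspace η α ι,
      ∀ x y, (∀ e, x e = none ↔ y e = none) →
        c (V.mapLetters some x) = c (V.mapLetters some y) := by
  induction η using Finite.induction_empty_option generalizing K with
  | of_equiv e ih =>
    obtain ⟨ι, hι, H⟩ := ih K
    refine ⟨ι, hι, fun c => ?_⟩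
    obtain ⟨V, hV⟩ := H c
    refine ⟨V.reindex e (Equiv.refl _) (Equiv.refl _), fun x y hxy => ?_⟩
    have : ∀ x, (V.reindex e (Equiv.refl _) (Equiv.refl _)).mapLetters some x =
        V.mapLetters some (x ∘ e) := by
      intro x
      ext i : 1
      cases h : V.idxFun i <;> simp [Subspace.coe_apply, Subspace.mapLetters, h, Subspace.reindex]
    rw [this, this]
    exact hV _ _ fun _ => hxy _
  | h_empty =>
    refine ⟨PEmpty, inferInstance, fun c => ⟨⟨PEmpty.elim, fun e => e.elim⟩, fun x y _ => ?_⟩⟩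
    rw [Subsingleton.elim x y]
  | h_option ih =>
    rename_i η _
    obtain ⟨ι, _, H⟩ := ih (K × K)
    obtain ⟨κ, _, Hκ⟩ := Line.exists_mono_in_high_dimension α ((ι → Option α) → K)
    refine ⟨κ ⊕ ι, inferInstance, fun c => ?_⟩
    obtain ⟨L, g, hL⟩ := Hκ fun z w => c (Sum.elim (some ∘ z) w)
    obtain ⟨a₀⟩ := ‹Nonempty α›
    obtain ⟨V, hV⟩ := H fun w => (c (Sum.elim (L.map some none) w), g w)
    refine ⟨Subspace.lineProd L V, fun x y hxy => ?_⟩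
    have hmap : (Subspace.lineProd L V).mapLetters some =
        Subspace.lineProd (L.map some) (V.mapLetters some) := by
      ext i : 2
      rcases i with i | i
      · cases h : L.idxFun i <;> simp [Subspace.mapLetters, Subspace.lineProd, Line.map, h]
      · cases h : V.idxFun i <;> simp [Subspace.mapLetters, Subspace.lineProd, h]
    have hsome : ∀ a w, c (Sum.elim (L.map some (some a)) w) = g w := by
      intro a w
      rw [Line.map_apply]
      exact congrFun (hL a) w
    have hVxy := hV (x ∘ some) (y ∘ some) fun e => hxy (some e)
    rw [Prod.mk.injEq] at hVxy
    rw [hmap, Subspace.lineProd_apply, Subspace.lineProd_apply]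
    have hxy0 := hxy none
    cases hx : x none with
    | none =>
      rw [hxy0.1 hx]
      exact hVxy.1
    | some a =>
      obtain ⟨b, hb⟩ : ∃ b, y none = some b :=
        Option.ne_none_iff_exists'.1 fun hy => by simp [hxy0.2 hy] at hx
      rw [hb, hsome, hsome]
      exact hVxy.2

/-- Graham–Rothschild theorem for lines: words containing `none` encode lines of a subspace. -/
lemma exists_subspace_lines_mono [Finite α] [Nonempty α] (η : Type) [Finite η] :
    ∃ (ι : Type) (_ : Finite ι), ∀ G : (ι → Option α) → Prop, ∃ V : Subspace η α ι,
      (∀ x, (∃ e, x e = none) → G (V.mapLetters some x)) ∨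
        ∀ x, (∃ e, x e = none) → ¬G (V.mapLetters some x) := by
  obtain ⟨κ, _, Hκ⟩ := exists_hasUnions η η
  obtain ⟨ι, hι, H⟩ := exists_subspace_color_eq (α := α) κ Prop
  obtain ⟨a₀⟩ := ‹Nonempty α›
  refine ⟨ι, hι, fun G => ?_⟩
  obtain ⟨V, hV⟩ := H G
  have key : ∀ G' : (ι → Option α) → Prop, (∀ x y, (∀ e, x e = none ↔ y e = none) →
      G' (V.mapLetters some x) = G' (V.mapLetters some y)) →
      HasUnions (fun y : κ → Bool =>
        G' (V.mapLetters some fun i => if y i then none else some a₀)) η →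
      ∃ V : Subspace η α ι, ∀ x, (∃ e, x e = none) → G' (V.mapLetters some x) := by
    rintro G' hG' ⟨J, hJ, hJG⟩
    let W : Subspace η α κ := ⟨fun i => (J i).elim (Sum.inl a₀) Sum.inr, fun e => by
      obtain ⟨i, hi⟩ := hJ e
      exact ⟨i, by simp [hi]⟩⟩
    refine ⟨V.comp W, fun x hx => ?_⟩
    have h1 : (V.comp W).mapLetters some x = V.mapLetters some (W.mapLetters some x) := by
      ext i : 1
      cases h : V.idxFun i <;> simp [Subspace.coe_apply, Subspace.mapLetters, Subspace.comp, h]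
    have h2 := hJG (fun e => (x e).isNone) (by simpa using hx)
    rw [h1]
    refine (hG' _ _ fun i => ?_).mp h2
    cases h : J i with
    | none => simp [unionOf, h, Subspace.coe_apply, Subspace.mapLetters, W]
    | some e => cases hx : x e <;>
      simp [unionOf, h, Subspace.coe_apply, Subspace.mapLetters, W, hx]
  rcases Hκ fun y => G (V.mapLetters some fun i => if y i then none else some a₀) with h | h
  · obtain ⟨V', hV'⟩ := key G hV h
    exact ⟨V', Or.inl hV'⟩
  · obtain ⟨V', hV'⟩ := key (fun x => ¬G x) (fun x y hxy => congrArg Not (hV x y hxy)) h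
    exact ⟨V', Or.inr hV'⟩

end GrahamRothschild

section DensityHalesJewett

variable {α β η κ ι ρ : Type}

/-- A function bounded by one that correlates with an intersection of insensitive sets has positive
average on some large subspace. -/
lemma DensityHJ.exists_avg_pos_of_forall_insensitive [Finite α] (h : DensityHJ α) (s : Finset α) :
    ∀ (η : Type) [Finite η] {ε : ℝ}, 0 < ε →
    ∃ (ι : Type) (_ : Finite ι), ∀ D : α → (ι → Option α) → Prop, (∀ a, Insensitive a (D a)) →
      ∀ f : (ι → Option α) → ℝ, (∀ x, f x ≤ 1) →
        ε ≤ avg (fun x => f x * ind (∀ a ∈ s, D a x)) →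
        ∃ V : Subspace η (Option α) ι, 0 < avg fun x => f (V x) := by
  classical
  induction s using Finset.induction_on with
  | empty =>
    intro η _ ε hε
    refine ⟨η, inferInstance, fun D _ f _ hf => ⟨Subspace.refl _ _, ?_⟩⟩
    simp only [Finset.notMem_empty, false_imp_iff, implies_true, ind_of_true, mul_one] at hf
    exact hε.trans_le hf
  | insert b s _ ih =>
    intro η _ ε hε
    obtain ⟨κ, _, Hκ⟩ := ih η (half_pos hε)
    obtain ⟨ι, hι, H⟩ := h.exists_avg_pos_of_insensitive b κ (half_pos hε)
    refine ⟨ι, hι, fun D hD f hf hcor => ?_⟩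
    obtain ⟨U, hU⟩ := H (D b) (hD b) (fun x => f x * ind (∀ a ∈ s, D a x) - ε / 2)
      (fun x => by
        have := mul_le_of_le_one_left (ind_nonneg (∀ a ∈ s, D a x)) (hf x)
        linarith [ind_le_one (∀ a ∈ s, D a x)])
      (by
        have h1 := avg_mono (f := fun x => f x * ind (∀ a ∈ insert b s, D a x) - ε / 2)
          (g := fun x => (f x * ind (∀ a ∈ s, D a x) - ε / 2) * ind (D b x)) fun x => by
            rw [Finset.forall_mem_insert, ind_and]
            nlinarith [ind_le_one (D b x)]
        rw [avg_sub, avg_const] at h1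
        linarith)
    rw [avg_sub, avg_const] at hU
    obtain ⟨V, hV⟩ := Hκ (fun a x => D a (U x)) (fun a => (hD a).comp_subspace U)
      (fun x => f (U x)) (fun x => hf _) (by linarith)
    exact ⟨U.comp V, by simpa only [Subspace.comp_apply] using hV⟩

end DensityHalesJewett

section DensityIncrement

variable {α η κ ι ρ : Type}

/-- Replace every occurrence of the letter `none` by `a`. -/
def fillWith (a : α) (x : ι → Option α) : ι → α := fun i => (x i).getD a

lemma ExchangeRel.fillWith_eq {a : α} {x y : ι → Option α} (h : ExchangeRel a x y) :
    fillWith a x = fillWith a y := by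
  ext i
  rcases h i with h | ⟨h | h, h' | h'⟩ <;> simp [fillWith, *]

lemma fillWith_mapLetters (a : α) (V : Subspace η α ι) (x : η → Option α) :
    fillWith a (V.mapLetters some x) = V (fillWith a x) := by
  ext i
  cases h : V.idxFun i <;> simp [fillWith, Subspace.coe_apply, Subspace.mapLetters, h]

lemma exists_avg_forall_ne_none_le [Finite α] {ν : ℝ} (hν : 0 < ν) :
    ∃ s : ℕ, avg (fun x : Fin s → Option α => ind (∀ i, x i ≠ none)) ≤ ν := by
  have hk : (Nat.card α : ℝ) / (Nat.card α + 1) < 1 := by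
    rw [div_lt_one (by positivity)]
    linarith
  obtain ⟨s, hs⟩ := exists_pow_lt_of_lt_one hν hk
  refine ⟨s, ?_⟩
  have hφ : Function.Injective fun y : Fin s → α => some ∘ y :=
    fun x y h => funext fun i => Option.some_injective _ (congrFun h i)
  have h1 := avg_mono (f := fun x : Fin s → Option α => ind (∀ i, x i ≠ none))
    (g := fun x => 1 * ind (x ∈ Set.range fun y : Fin s → α => some ∘ y)) fun x => by
      rw [one_mul]
      refine ind_mono fun hx => ?_
      choose y hy using fun i => Option.ne_none_iff_exists'.1 (hx i)
      exact ⟨y, funext fun i => (hy i).symm⟩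
  rw [avg_mul_ind_range hφ fun _ => 1] at h1
  have h2 : avg (fun _ : Fin s → α => (1 : ℝ)) ≤ 1 := avg_le_const zero_le_one fun _ => le_rfl
  have h3 : (Nat.card (Fin s → α) : ℝ) / Nat.card (Fin s → Option α) =
      ((Nat.card α : ℝ) / (Nat.card α + 1)) ^ s := by
    rw [Nat.card_fun, Nat.card_fun, Finite.card_option, div_pow]
    simp
  calc _ ≤ _ := h1
    _ ≤ (Nat.card (Fin s → α) : ℝ) / Nat.card (Fin s → Option α) :=
        mul_le_of_le_one_right (by positivity) h2
    _ ≤ ν := by rw [h3]; exact hs.le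

lemma exists_avg_mul_ind_of_not_forall {X : Type} [Finite X] (f : X → ℝ) (C : α → X → Prop)
    (s : Finset α) {ε : ℝ} (hε : 0 < ε) (h : ε ≤ avg fun x => f x * ind (¬∀ a ∈ s, C a x)) :
    ∃ D : α → X → Prop,
      (∀ a, D a = C a ∨ (D a = fun x => ¬C a x) ∨ D a = fun _ => True) ∧
      ε / 2 ^ s.card ≤ avg fun x => f x * ind (∀ a, D a x) := by
  classical
  induction s using Finset.induction_on generalizing ε with
  | empty =>
    simp only [Finset.notMem_empty, false_imp_iff, implies_true, not_true, ind_of_false not_false,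
      mul_zero] at h
    linarith [avg_le_const (X := X) (f := fun _ => 0) le_rfl fun _ => le_rfl]
  | insert b s hb ih =>
    have hsplit : ∀ x, f x * ind (¬∀ a ∈ insert b s, C a x) =
        f x * ind (¬∀ a ∈ s, C a x) + f x * ind (¬C b x ∧ ∀ a ∈ s, C a x) := by
      intro x
      rw [Finset.forall_mem_insert, ind_not, ind_not, ind_and, ind_and, ind_not]
      ring
    simp only [hsplit, avg_add] at h
    rw [Finset.card_insert_of_notMem hb]
    by_cases h1 : ε / 2 ≤ avg fun x => f x * ind (¬∀ a ∈ s, C a x)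
    · obtain ⟨D, hD, h2⟩ := ih (half_pos hε) h1
      exact ⟨D, hD, by rwa [pow_succ', ← div_div]⟩
    · have h2 : ε / 2 ≤ avg fun x => f x * ind (¬C b x ∧ ∀ a ∈ s, C a x) := by
        rw [not_le] at h1
        linarith
      refine ⟨fun a => if a = b then fun x => ¬C a x else if a ∈ s then C a else fun _ => True,
        fun a => by dsimp only; split_ifs <;> simp, ?_⟩
      have h3 : ∀ x, (∀ a, (if a = b then fun x => ¬C a x else
          if a ∈ s then C a else fun _ => True) x) ↔ ¬C b x ∧ ∀ a ∈ s, C a x := by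
        refine fun x => ⟨fun h => ⟨by simpa using h b, fun a ha => ?_⟩, fun h a => ?_⟩
        · have := h a
          rwa [if_neg (ne_of_mem_of_not_mem ha hb), if_pos ha] at this
        · split_ifs with h1 h2
          · exact h1 ▸ h.1
          · exact h.2 a h2
          · trivial
      simp only [h3]
      refine le_trans ?_ h2
      rw [pow_succ', ← div_div]
      exact div_le_self (half_pos hε).le (one_le_pow₀ one_le_two)

/-- The line of words obtained from `z` by substituting letters for `none`. -/
def lineOfWord (z : ι → Option α) (hz : ∃ i, z i = none) : Line (Option α) ι where
  idxFun i := (z i).map some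
  proper := by
    obtain ⟨i, hi⟩ := hz
    exact ⟨i, by simp [hi]⟩

lemma lineOfWord_none (z : ι → Option α) (hz : ∃ i, z i = none) : lineOfWord z hz none = z := by
  ext i : 1
  cases h : z i <;> simp [lineOfWord, h]

lemma lineOfWord_some (z : ι → Option α) (hz : ∃ i, z i = none) (a : α) :
    lineOfWord z hz (some a) = some ∘ fillWith a z := by
  ext i : 1
  cases h : z i <;> simp [lineOfWord, h, fillWith]

/-- A set with uniform sections contains, unless it contains a line, a subspace all of whose lines
are good for many sections. -/
lemma DensityHJ.exists_subspace_lines_dense [Finite α] [Nonempty α] (h : DensityHJ α) {δ₀ : ℝ}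
    (hδ₀ : 0 < δ₀) :
    ∃ θ : ℝ, 0 < θ ∧ θ ≤ δ₀ ∧ ∃ (κ₀ : Type) (_ : Finite κ₀), ∀ (σ : Type) [Finite σ],
      ∃ (κ : Type) (_ : Finite κ), ∀ (ρ : Type) [Finite ρ] (Q : (κ → Option α) →
        (ρ → Option α) → Prop), (∀ z, δ₀ ≤ avg fun w => ind (Q z w)) →
        ∃ V : Subspace (κ₀ ⊕ σ) α κ, ∀ x, (∃ e, x e = none) →
          θ ≤ avg fun w => ind (∀ a, Q (some ∘ V (fillWith a x)) w) := by
  obtain ⟨κ₀, hκ₀, H₀⟩ := h (δ₀ / 2) (by linarith)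
  refine ⟨δ₀ / 2 / (Nat.card (Line α κ₀) + 1), by positivity, ?_, κ₀, hκ₀, fun σ _ => ?_⟩
  · exact (div_le_self (by positivity) (by simp)).trans (by linarith)
  obtain ⟨κ, hκ, H⟩ := exists_subspace_lines_mono (α := α) (κ₀ ⊕ σ)
  obtain ⟨a₀⟩ := ‹Nonempty α›
  have : Nonempty α := ⟨a₀⟩
  refine ⟨κ, hκ, fun ρ _ Q hQ => ?_⟩
  obtain ⟨V, hV⟩ := H fun z => δ₀ / 2 / (Nat.card (Line α κ₀) + 1) ≤
    avg fun w : ρ → Option α => ind (∀ a, Q (some ∘ fillWith a z) w)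
  simp only [fillWith_mapLetters] at hV
  refine ⟨V, hV.resolve_right fun hbad => ?_⟩
  have h1 := avg_mono (f := fun _ : κ₀ → α => δ₀) (g := fun u => avg fun w =>
    ind (Q (some ∘ V (Sum.elim u fun _ => a₀)) w)) fun u => hQ _
  rw [avg_const, avg_comm] at h1
  obtain ⟨L, hL⟩ := exists_witness (J := Line α κ₀)
    (q := fun L w => ∀ a, Q (some ∘ V (Sum.elim (L a) fun _ => a₀)) w) (by linarith)
    (fun w hw => H₀ (fun u => Q (some ∘ V (Sum.elim u fun _ => a₀)) w) hw)
    (half_le_avg_ind hδ₀ (fun _ => avg_ind_le_one _) h1)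
  obtain ⟨j, hj⟩ := L.proper
  refine hbad (Sum.elim L.idxFun fun _ => some a₀) ⟨Sum.inl j, hj⟩ (hL.trans_eq ?_)
  have : ∀ a, fillWith a (Sum.elim L.idxFun fun _ : σ => some a₀) =
      Sum.elim (L a) fun _ => a₀ := by
    intro a
    ext (i | i) <;> simp [fillWith, Line.apply_def]
  simp only [this]

/-- A dense line-free set correlates, on some subspace, with an intersection of insensitive sets. -/
lemma DensityHJ.exists_increment [Finite α] [Nonempty α] (h : DensityHJ α) {δ₀ : ℝ}
    (hδ₀ : 0 < δ₀) :
    ∃ γ : ℝ, 0 < γ ∧ ∀ (τ : Type) [Finite τ], ∃ (ι : Type) (_ : Finite ι),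
      ∀ δ : ℝ, δ₀ ≤ δ → ∀ P : (ι → Option α) → Prop, δ ≤ avg (fun x => ind (P x)) →
        (∀ L : Line (Option α) ι, ¬∀ b, P (L b)) →
        ∃ (V : Subspace τ (Option α) ι) (D : α → (τ → Option α) → Prop),
          (∀ a, Insensitive a (D a)) ∧
            γ ≤ avg fun x => (ind (P (V x)) - δ - γ) * ind (∀ a, D a x) := by
  cases nonempty_fintype α
  obtain ⟨θ, hθ, hθδ, κ₀, hκ₀, H₀⟩ := h.exists_subspace_lines_dense (half_pos hδ₀)
  set ν : ℝ := δ₀ * θ / 8 with hν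
  have hνpos : 0 < ν := by positivity
  obtain ⟨s, hs⟩ := exists_avg_forall_ne_none_le (α := α) hνpos
  set n := (Finset.univ : Finset α).card with hn
  have hn1 : 2 * ν / 2 ^ n ≤ 2 * ν := div_le_self (by positivity) (one_le_pow₀ one_le_two)
  refine ⟨min ν (2 * ν / 2 ^ n), by positivity, fun τ _ => ?_⟩
  obtain ⟨κ, hκ, H⟩ := H₀ (Fin s ⊕ τ)
  obtain ⟨ι, hι, Hι⟩ := exists_uniform_sections (β := Option α) κ hνpos
  refine ⟨ι, hι, fun δ hδ P hP hline => ?_⟩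
  have hδ1 : δ ≤ 1 := hP.trans (avg_ind_le_one P)
  have hν1 : ν ≤ δ₀ / 2 := by
    rw [hν]
    nlinarith
  obtain ⟨ρ, hρ, W, hW⟩ := Hι P δ (hδ₀.le.trans hδ) hP
  obtain ⟨V, hV⟩ := H ρ (fun z w => P (W (Sum.elim z w))) fun z => by linarith [hW z]
  set A : (κ₀ ⊕ Fin s ⊕ τ → Option α) → (ρ → Option α) → Prop :=
    fun x w => P (W (Sum.elim (V.mapLetters some x) w)) with hA
  set C : α → (ρ → Option α) → (κ₀ ⊕ Fin s ⊕ τ → Option α) → Prop :=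
    fun a w x => P (W (Sum.elim (some ∘ V (fillWith a x)) w)) with hC
  have hCins : ∀ a w, Insensitive a (C a w) := fun a w x y hxy => by
    simp only [hC, hxy.fillWith_eq]
  have hdisj : ∀ x w, (∃ e, x e = none) → A x w → ¬∀ a, C a w x := by
    rintro x w ⟨e, he⟩ hAx hCx
    obtain ⟨i, hi⟩ := V.proper e
    have hz : ∃ i, V.mapLetters some x i = none :=
      ⟨i, by simp [Subspace.coe_apply, Subspace.mapLetters, hi, he]⟩
    refine hline (W.compLine ((lineOfWord _ hz).horizontal w)) fun b => ?_
    rw [Subspace.compLine_apply, Line.horizontal_apply]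
    cases b with
    | none => rwa [lineOfWord_none]
    | some a =>
      rw [lineOfWord_some, fillWith_mapLetters]
      exact hCx a
  have hF : ∀ x, 6 * ν - 3 * ind (∀ i : Fin s, x (Sum.inr (Sum.inl i)) ≠ none) ≤
      avg fun w => (ind (A x w) - δ - ν) * ind (¬∀ a ∈ Finset.univ, C a w x) := by
    intro x
    simp only [Finset.mem_univ, true_imp_iff]
    by_cases hx : ∃ e, x e = none
    · have h1 : ∀ w, ind (A x w) - (δ + ν) + (δ + ν) * ind (∀ a, C a w x) =
          (ind (A x w) - δ - ν) * ind (¬∀ a, C a w x) := by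
        intro w
        rw [ind_not]
        by_cases hAx : A x w
        · rw [ind_of_false (hdisj x w hx hAx)]
          ring
        · rw [ind_of_false hAx]
          ring
      simp only [← h1]
      rw [avg_add, avg_sub, avg_const, avg_const_mul]
      have h2 := hW (V.mapLetters some x)
      have h3 := hV x hx
      have h4 : δ₀ * θ ≤ (δ + ν) * avg fun w => ind (∀ a, C a w x) :=
        mul_le_mul (by linarith) h3 hθ.le (by linarith)
      have h5 := ind_nonneg (∀ i : Fin s, x (Sum.inr (Sum.inl i)) ≠ none)
      linarith
    · push Not at hx
      rw [ind_of_true fun i => hx _]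
      have h1 := avg_mono (f := fun _ : ρ → Option α => (-2 : ℝ))
        (g := fun w => (ind (A x w) - δ - ν) * ind (¬∀ a, C a w x)) fun w => by
          have h1 := ind_nonneg (A x w)
          have h2 := ind_nonneg (¬∀ a, C a w x)
          have h3 := ind_le_one (¬∀ a, C a w x)
          nlinarith
      rw [avg_const] at h1
      nlinarith
  have h1 := avg_mono hF
  rw [avg_sub, avg_const, avg_const_mul, avg_comm] at h1
  have h2 : avg (fun x : κ₀ ⊕ Fin s ⊕ τ → Option α =>
      ind (∀ i : Fin s, x (Sum.inr (Sum.inl i)) ≠ none)) ≤ ν := by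
    rw [avg_sum_arrow']
    simp only [Sum.elim_inr, avg_const]
    rw [avg_sum_arrow]
    simpa only [Sum.elim_inl, avg_const] using hs
  obtain ⟨w, hw⟩ := exists_avg_le fun w : ρ → Option α =>
    avg fun x => (ind (A x w) - δ - ν) * ind (¬∀ a ∈ Finset.univ, C a w x)
  obtain ⟨D, hD, hDavg⟩ := exists_avg_mul_ind_of_not_forall (ε := 2 * ν)
    (fun x => ind (A x w) - δ - ν) (fun a => C a w) Finset.univ (by positivity) (by linarith)
  have hDins : ∀ a, Insensitive a (D a) := by
    intro a
    rcases hD a with h | h | h <;> rw [h]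
    · exact hCins a w
    · exact (hCins a w).not
    · exact Insensitive.true a
  rw [avg_sum_arrow] at hDavg
  obtain ⟨y₁, hy₁⟩ := exists_avg_le fun y : κ₀ → Option α => avg fun z =>
    (fun x => (ind (A x w) - δ - ν) * ind (∀ a, D a x)) (Sum.elim y z)
  have hDavg := hDavg.trans hy₁
  rw [avg_sum_arrow] at hDavg
  obtain ⟨y₂, hy₂⟩ := exists_avg_le fun y : Fin s → Option α => avg fun z =>
    (fun x => (ind (A x w) - δ - ν) * ind (∀ a, D a x)) (Sum.elim y₁ (Sum.elim y z))
  have hDavg := hDavg.trans hy₂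
  refine ⟨W.comp (Subspace.prodConst ((V.mapLetters some).comp
    (Subspace.constProd y₁ (Subspace.constProd y₂ (Subspace.refl _ _)))) w),
    fun a x => D a (Sum.elim y₁ (Sum.elim y₂ x)),
    fun a x y hxy => hDins a _ _ ((hxy.elim_right y₂).elim_right y₁), ?_⟩
  simp only [Subspace.comp_apply, Subspace.prodConst_apply, Subspace.constProd_apply,
    Subspace.refl_apply]
  refine (min_le_right _ _).trans (hDavg.trans (avg_mono fun x => ?_))
  refine mul_le_mul_of_nonneg_right ?_ (ind_nonneg _)
  have := min_le_left ν (2 * ν / 2 ^ n)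
  simp only [hA]
  linarith

end DensityIncrement

section DensityHalesJewettTheorem

variable {α β : Type}

lemma DensityHJ.of_equiv [Finite α] [Finite β] (e : α ≃ β) (h : DensityHJ α) : DensityHJ β := by
  intro δ hδ
  obtain ⟨ι, hι, H⟩ := h δ hδ
  refine ⟨ι, hι, fun P hP => ?_⟩
  rw [← avg_equiv (Equiv.arrowCongr (Equiv.refl ι) e)] at hP
  obtain ⟨L, hL⟩ := H _ hP
  refine ⟨L.map e, fun b => ?_⟩
  have := hL (e.symm b)
  rwa [show Equiv.arrowCongr (Equiv.refl ι) e (L (e.symm b)) = L.map e b by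
    conv_rhs => rw [← e.apply_symm_apply b, Line.map_apply]
    rfl] at this

lemma densityHJ_of_subsingleton [Finite α] [Subsingleton α] : DensityHJ α := by
  intro δ hδ
  refine ⟨Unit, inferInstance, fun P hP => ⟨Line.diagonal α Unit, fun b => ?_⟩⟩
  by_contra hb
  have := avg_le_const (f := fun x => ind (P x)) le_rfl fun x =>
    (ind_of_false (Subsingleton.elim (Line.diagonal α Unit b) x ▸ hb)).le
  linarith

lemma DensityHJ.option [Finite α] [Nonempty α] (h : DensityHJ α) : DensityHJ (Option α) := by
  cases nonempty_fintype α
  intro δ₀ hδ₀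
  obtain ⟨γ, hγ, Hinc⟩ := h.exists_increment hδ₀
  have key : ∀ t : ℕ, ∃ (ι : Type) (_ : Finite ι), ∀ δ : ℝ, δ₀ ≤ δ → 1 - t * γ < δ →
      ∀ P : (ι → Option α) → Prop, δ ≤ avg (fun x => ind (P x)) →
        ∃ L : Line (Option α) ι, ∀ b, P (L b) := by
    intro t
    induction t with
    | zero =>
      refine ⟨PEmpty, inferInstance, fun δ _ h1 P hP => ?_⟩
      have := avg_ind_le_one P
      simp only [CharP.cast_eq_zero, zero_mul, sub_zero] at h1
      linarith
    | succ t ih =>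
      obtain ⟨η, _, Hη⟩ := ih
      obtain ⟨κ, _, Hκ⟩ := h.exists_avg_pos_of_forall_insensitive Finset.univ η hγ
      obtain ⟨ι, hι, H⟩ := Hinc κ
      refine ⟨ι, hι, fun δ hδ hδt P hP => ?_⟩
      by_contra! hno
      obtain ⟨V, D, hD, hcor⟩ := H δ hδ P hP fun L hL => (hno L).elim fun b hb => hb (hL b)
      obtain ⟨U, hU⟩ := Hκ D hD (fun x => ind (P (V x)) - δ - γ)
        (fun x => by linarith [ind_le_one (P (V x))])
        (by simpa only [Finset.mem_univ, true_imp_iff] using hcor)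
      rw [avg_sub, avg_sub, avg_const, avg_const] at hU
      obtain ⟨L, hL⟩ := Hη (δ + γ) (by linarith) (by push_cast at hδt; linarith)
        (fun x => P (V (U x))) (by linarith)
      obtain ⟨b, hb⟩ := hno (V.compLine (U.compLine L))
      rw [Subspace.compLine_apply, Subspace.compLine_apply] at hb
      exact hb (hL b)
  obtain ⟨t, ht⟩ := exists_nat_gt (1 / γ)
  rw [div_lt_iff₀ hγ] at ht
  obtain ⟨ι, hι, H⟩ := key t
  exact ⟨ι, hι, H δ₀ le_rfl (by linarith)⟩

/-- The density Hales–Jewett theorem. -/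
theorem densityHJ (β : Type) [Finite β] : DensityHJ β := by
  refine Finite.induction_empty_option (P := fun β => ∀ _ : Finite β, DensityHJ β) ?_ ?_ ?_ β _
  · intro α β e ih _
    have := Finite.of_equiv _ e.symm
    exact (ih _).of_equiv e
  · exact fun _ => densityHJ_of_subsingleton
  · intro β _ ih _
    rcases isEmpty_or_nonempty β with hβ | hβ
    · exact densityHJ_of_subsingleton
    · exact (ih _).option

end DensityHalesJewettTheorem

section LargeAbelianSubgroups

variable {G : Type*} [Group G]

/-- A normal abelian subgroup of a finite `p`-group that is properly contained in its centralizer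
is properly contained in another normal abelian subgroup. -/
lemma IsPGroup.exists_lt_normal_commute {p : ℕ} [Fact p.Prime] [Finite G] (hG : IsPGroup p G)
    (A : Subgroup G) [A.Normal] (hA : ∀ x ∈ A, ∀ y ∈ A, x * y = y * x)
    (hC : ¬Subgroup.centralizer (A : Set G) ≤ A) :
    ∃ B : Subgroup G, A < B ∧ B.Normal ∧ ∀ x ∈ B, ∀ y ∈ B, x * y = y * x := by
  let π := QuotientGroup.mk' A
  have hπ : Function.Surjective π := QuotientGroup.mk'_surjective A
  let C := (Subgroup.centralizer (A : Set G)).map π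
  have : C.Normal := Subgroup.Normal.map inferInstance π hπ
  have hQ : IsPGroup p (ConjAct (G ⧸ A)) := (hG.to_quotient A).of_equiv ConjAct.toConjAct
  have hCcard : p ∣ Nat.card C := by
    refine (((hG.to_quotient A).to_subgroup C).card_eq_or_dvd).resolve_left fun h => hC ?_
    rw [Subgroup.card_eq_one, Subgroup.map_eq_bot_iff, QuotientGroup.ker_mk'] at h
    exact h
  obtain ⟨⟨b, hbC⟩, hb, hb1⟩ := hQ.exists_fixed_point_of_prime_dvd_card_of_fixed_point C hCcard
    (a := 1) fun g => smul_one g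
  obtain ⟨x, hxC, rfl⟩ := hbC
  have hcenter : ∀ g, g * π x * g⁻¹ = π x := fun g => congrArg Subtype.val
    (hb (ConjAct.toConjAct g))
  have hxA : x ∉ A := fun h => hb1 (Subtype.ext ((QuotientGroup.eq_one_iff x).2 h).symm)
  have hmem : ∀ y ∈ (Subgroup.zpowers (π x)).comap π, ∃ n : ℤ, ∃ a ∈ A, y = x ^ n * a := by
    intro y hy
    obtain ⟨n, hn⟩ := Subgroup.mem_zpowers_iff.1 (Subgroup.mem_comap.1 hy)
    exact ⟨n, (x ^ n)⁻¹ * y, QuotientGroup.eq.1 (by simpa [π] using hn), by group⟩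
  have hnormal : (Subgroup.zpowers (π x)).Normal := by
    refine ⟨fun y hy g => ?_⟩
    obtain ⟨n, rfl⟩ := Subgroup.mem_zpowers_iff.1 hy
    rw [← conj_zpow, hcenter]
    exact hy
  refine ⟨(Subgroup.zpowers (π x)).comap π, lt_of_le_of_ne (fun y hy => ?_) fun h => hxA ?_,
    hnormal.comap π, fun y hy z hz => ?_⟩
  · rw [Subgroup.mem_comap, show π y = 1 from (QuotientGroup.eq_one_iff y).2 hy]
    exact one_mem _
  · rw [h]
    exact Subgroup.mem_zpowers (π x)
  · obtain ⟨n, a, ha, rfl⟩ := hmem y hy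
    obtain ⟨m, b, hb, rfl⟩ := hmem z hz
    have hx : ∀ a ∈ A, Commute x a := fun a ha => (Subgroup.mem_centralizer_iff.1 hxC a ha).symm
    have hab : Commute a b := hA a ha b hb
    exact (((Commute.refl x).zpow_zpow n m).mul_right ((hx b hb).zpow_left n)).mul_left
      (((hx a ha).zpow_left m).symm.mul_right hab)

lemma IsPGroup.exists_commute_card_le {p : ℕ} [Fact p.Prime] [Finite G] (hG : IsPGroup p G) :
    ∃ A : Subgroup G, (∀ x ∈ A, ∀ y ∈ A, x * y = y * x) ∧
      Nat.card G ≤ Nat.card A * Nat.card A ^ Nat.card A := by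
  obtain ⟨A, ⟨hAn, hA⟩, hmax⟩ := (Set.toFinite {A : Subgroup G | A.Normal ∧
    ∀ x ∈ A, ∀ y ∈ A, x * y = y * x}).exists_maximal ⟨⊥, inferInstance, by
      simp [Subgroup.mem_bot]⟩
  have hC : Subgroup.centralizer (A : Set G) ≤ A := by
    by_contra hC
    obtain ⟨B, hAB, hB⟩ := hG.exists_lt_normal_commute A hA hC
    exact hAB.not_ge (hmax hB hAB.le)
  refine ⟨A, hA, ?_⟩
  let f : G →* MulAut A := MulAut.conjNormal
  have hker : f.ker ≤ A := by
    refine le_trans (fun g hg => ?_) hC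
    rw [Subgroup.mem_centralizer_iff]
    intro a ha
    have h1 := congrArg Subtype.val (DFunLike.congr_fun (MonoidHom.mem_ker.1 hg) ⟨a, ha⟩)
    rw [MulAut.conjNormal_apply] at h1
    exact (mul_inv_eq_iff_eq_mul.1 h1).symm
  rw [← f.ker.card_mul_index, Subgroup.index_ker]
  refine Nat.mul_le_mul (Nat.card_le_card_of_injective _ (Subgroup.inclusion_injective hker)) ?_
  rw [← Nat.card_fun]
  exact (Nat.card_le_card_of_injective _ Subtype.val_injective).trans
    (Nat.card_le_card_of_injective (fun e : MulAut A => (e : A → A)) DFunLike.coe_injective)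

lemma card_le_card_ker_powMonoidHom_pow (p e : ℕ) (A : Type*) [CommGroup A] [Finite A]
    (h : ∀ a : A, a ^ p ^ e = 1) :
    Nat.card A ≤ Nat.card (powMonoidHom p : A →* A).ker ^ e := by
  induction e generalizing A with
  | zero =>
    have : Subsingleton A := ⟨fun a b => by simpa using (h a).trans (h b).symm⟩
    simp
  | succ e ih =>
    let f : A →* A := powMonoidHom p
    have h1 := ih f.range fun ⟨_, a, rfl⟩ => Subtype.ext (by
      simpa [f, ← pow_mul, ← pow_succ'] using h a)
    have h2 : Nat.card (powMonoidHom p : f.range →* f.range).ker ≤ Nat.card f.ker :=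
      Nat.card_le_card_of_injective
        (fun x => ⟨x.1.1, congrArg Subtype.val (MonoidHom.mem_ker.1 x.2)⟩)
        fun x y hxy => Subtype.ext (Subtype.ext (congrArg (fun z : f.ker => (z : A)) hxy))
    calc Nat.card A = Nat.card f.ker * Nat.card f.range := by
          rw [← f.ker.card_mul_index, Subgroup.index_ker]
      _ ≤ Nat.card f.ker * Nat.card f.ker ^ e :=
          Nat.mul_le_mul_left _ (h1.trans (Nat.pow_le_pow_left h2 e))
      _ = _ := (pow_succ' _ _).symm

lemma exists_injective_of_pow_card_le {p : ℕ} [Fact p.Prime] (E : Type*) [CommGroup E] [Finite E]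
    (hE : ∀ a : E, a ^ p = 1) (J : Type*) [Finite J] (h : p ^ Nat.card J ≤ Nat.card E) :
    ∃ Φ : Multiplicative (J → ZMod p) →* E, Function.Injective Φ := by
  cases nonempty_fintype J
  let : Module (ZMod p) (Additive E) := AddCommGroup.zmodModule (n := p) fun x => hE x.toMul
  have hcard := Module.natCard_eq_pow_finrank (K := ZMod p) (V := Additive E)
  rw [Nat.card_zmod] at hcard
  have hrank : Nat.card J ≤ Module.finrank (ZMod p) (Additive E) :=
    (Nat.pow_le_pow_iff_right (Fact.out : p.Prime).one_lt).1 (h.trans_eq hcard)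
  obtain ⟨v, hv⟩ := exists_linearIndependent_of_le_finrank hrank
  have hv' := hv.comp _ (Finite.equivFin J).injective
  let Φ := (Fintype.linearCombination (ZMod p) (v ∘ Finite.equivFin J)).toAddMonoidHom
  exact ⟨Φ.toMultiplicativeLeft, hv'.fintypeLinearCombination_injective⟩

/-- A sufficiently large finite group contains an element of large order or an elementary abelian
subgroup of large rank. -/
lemma exists_orderOf_gt_or_exists_injective (M : ℕ) (J : Type) [Finite J] :
    ∃ n₀ : ℕ, ∀ (Γ : Type) [Group Γ] [Finite Γ], n₀ ≤ Nat.card Γ →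
      (∃ h : Γ, M < orderOf h) ∨
        ∃ p : ℕ, p.Prime ∧ ∃ Φ : Multiplicative (J → ZMod p) →* Γ, Function.Injective Φ := by
  set m := (M ^ Nat.card J) ^ M with hm
  refine ⟨(m * m ^ m + 1) ^ (M + 1) + 1, fun Γ _ _ hΓ => ?_⟩
  by_contra! hcon
  obtain ⟨hord, hinj⟩ := hcon
  have hsylow : ∀ p ∈ (Nat.card Γ).primeFactors,
      p ≤ M ∧ p ^ (Nat.card Γ).factorization p ≤ m * m ^ m + 1 := by
    intro p hp
    have : Fact p.Prime := ⟨Nat.prime_of_mem_primeFactors hp⟩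
    have hp1 := (Fact.out : p.Prime).one_lt
    obtain ⟨g, hg⟩ := exists_prime_orderOf_dvd_card' (G := Γ) p (Nat.dvd_of_mem_primeFactors hp)
    have hpM : p ≤ M := hg ▸ hord g
    refine ⟨hpM, ?_⟩
    let P : Sylow p Γ := default
    rw [← P.card_eq_multiplicity]
    obtain ⟨A, hA, hPA⟩ := P.isPGroup'.exists_commute_card_le
    let : CommGroup A := { (inferInstance : Group A) with
      mul_comm := fun x y => Subtype.ext (hA x x.2 y y.2) }
    have hexp : ∀ a : A, a ^ p ^ M = 1 := by
      intro a
      obtain ⟨e, he⟩ := IsPGroup.iff_orderOf.1 (P.isPGroup'.to_subgroup A) a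
      have h1 : p ^ e ≤ M := by
        rw [← he, ← Subgroup.orderOf_coe, ← Subgroup.orderOf_coe]
        exact hord _
      have h2 : e ≤ M := (Nat.lt_pow_self hp1).le.trans h1
      exact orderOf_dvd_iff_pow_eq_one.1 (he ▸ pow_dvd_pow p h2)
    have h1 := card_le_card_ker_powMonoidHom_pow p M A hexp
    have h2 : Nat.card (powMonoidHom p : A →* A).ker ≤ M ^ Nat.card J := by
      by_contra! h3
      obtain ⟨Φ, hΦ⟩ := exists_injective_of_pow_card_le (p := p) (powMonoidHom p : A →* A).ker
        (fun a => Subtype.ext a.2) J ((Nat.pow_le_pow_left hpM _).trans h3.le)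
      exact hinj p Fact.out ((((P : Subgroup Γ).subtype.comp A.subtype).comp
        (Subgroup.subtype _)).comp Φ) (((P : Subgroup Γ).subtype_injective.comp
          (A.subtype_injective.comp (Subgroup.subtype_injective _))).comp hΦ)
    have h3 : Nat.card A ≤ m := h1.trans (Nat.pow_le_pow_left h2 M)
    have hA0 : 0 < Nat.card A := Nat.card_pos
    calc _ ≤ _ := hPA
      _ ≤ m * m ^ m := Nat.mul_le_mul h3
        ((Nat.pow_le_pow_left h3 _).trans (Nat.pow_le_pow_right (hA0.trans_le h3) h3))
      _ ≤ _ := Nat.le_succ _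
  have hcard : Nat.card Γ ≤ (m * m ^ m + 1) ^ (M + 1) := by
    conv_lhs => rw [← Nat.prod_factorization_pow_eq_self (n := Nat.card Γ) Nat.card_pos.ne']
    refine (Finset.prod_le_pow_card _ _ _ fun p hp => (hsylow p hp).2).trans
      (Nat.pow_le_pow_right (Nat.succ_pos _) ?_)
    refine (Finset.card_le_card (t := Finset.range (M + 1)) fun p hp => ?_).trans_eq
      (Finset.card_range _)
    exact Finset.mem_range.2 (Nat.lt_succ_of_le (hsylow p hp).1)
  omega

end LargeAbelianSubgroups

section Configurations

variable {V : Type*} [AddCommGroup V] [DecidableEq V]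

/-- The number of rows, columns and sums determined by a set of pairs. -/
def supportSize (F : Finset (V × V)) : ℕ :=
  (F.image fun q => q.1).card + (F.image fun q => q.2).card + (F.image fun q => q.1 + q.2).card

lemma card_image_insert_le {X Y : Type*} [DecidableEq X] [DecidableEq Y] (f : X → Y) (a : X)
    (F : Finset X) : ((insert a F).image f).card ≤ (F.image f).card + 1 := by
  rw [Finset.image_insert]
  exact Finset.card_insert_le _ _

lemma card_image_insert_of_mem {X Y : Type*} [DecidableEq X] [DecidableEq Y] {f : X → Y} {a : X}
    {F : Finset X} (h : f a ∈ F.image f) : ((insert a F).image f).card = (F.image f).card := by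
  rw [Finset.image_insert, Finset.insert_eq_of_mem h]

/-- If no pair outside `F` shares two of its row, column and sum with `F`, then one can add any pair
in a row of `F`. -/
lemma supportSize_insert_le_of_closed {F : Finset (V × V)} (hF : F.Nonempty)
    (h : ∀ q, supportSize F + 1 < supportSize (insert q F) ∨ q ∈ F) :
    (F.image fun q => q.2).card ≤ F.card ∧
      ∀ q, q.1 ∈ F.image (fun q => q.1) → supportSize (insert q F) ≤ F.card + 4 := by
  set R := F.image fun q => q.1 with hR
  set C := F.image fun q => q.2 with hC
  set S := F.image fun q => q.1 + q.2 with hS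
  have hRC : ∀ a ∈ R, ∀ b ∈ C, (a, b) ∈ F := fun a ha b hb => (h (a, b)).resolve_left fun hlt => by
    have h1 := card_image_insert_of_mem (f := fun q : V × V => q.1) (a := (a, b)) (F := F) ha
    have h2 := card_image_insert_of_mem (f := fun q : V × V => q.2) (a := (a, b)) (F := F) hb
    have h3 := card_image_insert_le (fun q : V × V => q.1 + q.2) (a, b) F
    simp only [supportSize] at hlt
    omega
  have hRS : ∀ a ∈ R, ∀ σ ∈ S, (a, σ - a) ∈ F := fun a ha σ hσ =>
    (h (a, σ - a)).resolve_left fun hlt => by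
      have h1 := card_image_insert_of_mem (f := fun q : V × V => q.1) (a := (a, σ - a)) (F := F) ha
      have h2 := card_image_insert_le (fun q : V × V => q.2) (a, σ - a) F
      have h3 := card_image_insert_of_mem (f := fun q : V × V => q.1 + q.2) (a := (a, σ - a))
        (F := F) (by simpa [hS] using hσ)
      simp only [supportSize] at hlt
      omega
  have hCS : ∀ b ∈ C, ∀ σ ∈ S, (σ - b, b) ∈ F := fun b hb σ hσ =>
    (h (σ - b, b)).resolve_left fun hlt => by
      have h1 := card_image_insert_le (fun q : V × V => q.1) (σ - b, b) F
      have h2 := card_image_insert_of_mem (f := fun q : V × V => q.2) (a := (σ - b, b)) (F := F) hb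
      have h3 := card_image_insert_of_mem (f := fun q : V × V => q.1 + q.2) (a := (σ - b, b))
        (F := F) (by simpa [hS] using hσ)
      simp only [supportSize] at hlt
      omega
  obtain ⟨⟨a₀, b₀⟩, h₀⟩ := hF
  have ha₀ : a₀ ∈ R := Finset.mem_image.2 ⟨_, h₀, rfl⟩
  have hb₀ : b₀ ∈ C := Finset.mem_image.2 ⟨_, h₀, rfl⟩
  have hRle : R.card ≤ S.card := Finset.card_le_card_of_injOn (· + b₀)
    (fun a ha => Finset.mem_coe.2 (Finset.mem_image.2 ⟨_, hRC a ha b₀ hb₀, rfl⟩))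
    fun _ _ _ _ => add_right_cancel
  have hCle : C.card ≤ S.card := Finset.card_le_card_of_injOn (a₀ + ·)
    (fun b hb => Finset.mem_coe.2 (Finset.mem_image.2 ⟨_, hRC a₀ ha₀ b hb, rfl⟩))
    fun _ _ _ _ => add_left_cancel
  have hSC : S.card ≤ C.card := Finset.card_le_card_of_injOn (· - a₀)
    (fun σ hσ => Finset.mem_coe.2 (Finset.mem_image.2 ⟨_, hRS a₀ ha₀ σ hσ, rfl⟩))
    fun _ _ _ _ => sub_left_inj.1
  have hSR : S.card ≤ R.card := Finset.card_le_card_of_injOn (· - b₀)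
    (fun σ hσ => Finset.mem_coe.2 (Finset.mem_image.2 ⟨_, hCS b₀ hb₀ σ hσ, rfl⟩))
    fun _ _ _ _ => sub_left_inj.1
  have hcard : R.card * C.card ≤ F.card := by
    rw [← Finset.card_product]
    exact Finset.card_le_card fun q hq =>
      hRC _ (Finset.mem_product.1 hq).1 _ (Finset.mem_product.1 hq).2
  refine ⟨Finset.card_image_le, fun q hq => ?_⟩
  have h1 := card_image_insert_of_mem (f := fun q : V × V => q.1) (a := q) (F := F) hq
  have h2 := card_image_insert_le (fun q : V × V => q.2) q F
  have h3 := card_image_insert_le (fun q : V × V => q.1 + q.2) q F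
  have hS1 : S.card = C.card := le_antisymm hSC hCle
  have hR1 : R.card = C.card := le_antisymm (hRle.trans hSC) (hCle.trans hSR)
  simp only [supportSize]
  rw [h1, ← hR, hR1]
  rw [hR1] at hcard
  rw [← hC] at h2
  rw [← hS] at h3
  have h4 : 3 * C.card ≤ C.card * C.card + 2 := by
    obtain hu | hu | hu : C.card = 0 ∨ C.card = 1 ∨ 2 ≤ C.card := by omega
    · simp [hu]
    · simp [hu]
    · nlinarith [sq_nonneg ((C.card : ℤ) - 2)]
  omega

/-- In a large abelian group there are `k` pairs determining at most `k + 3` rows, columns and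
sums in total. -/
lemma exists_supportSize_le (k : ℕ) (hV : ∀ C : Finset V, C.card < k → ∃ c, c ∉ C) :
    ∃ F : Finset (V × V), F.card = k ∧ supportSize F ≤ k + 3 := by
  suffices ∀ j ≤ k, ∃ F : Finset (V × V), F.card = j ∧ supportSize F ≤ j + 3 from this k le_rfl
  intro j
  induction j with
  | zero => exact fun _ => ⟨∅, rfl, by simp [supportSize]⟩
  | succ j ih =>
    intro hj
    obtain ⟨F, hFj, hF⟩ := ih (by omega)
    rcases F.eq_empty_or_nonempty with rfl | hne
    · refine ⟨{(0, 0)}, by simp [← hFj], by simp [supportSize]⟩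
    by_cases h : ∀ q, supportSize F + 1 < supportSize (insert q F) ∨ q ∈ F
    · obtain ⟨hC, hins⟩ := supportSize_insert_le_of_closed hne h
      obtain ⟨c, hc⟩ := hV _ (hC.trans_lt (by omega))
      obtain ⟨q, hq⟩ := hne
      refine ⟨insert (q.1, c) F, ?_, ?_⟩
      · rw [Finset.card_insert_of_notMem fun hqF => hc (Finset.mem_image.2 ⟨_, hqF, rfl⟩), hFj]
      · have := hins (q.1, c) (Finset.mem_image.2 ⟨q, hq, rfl⟩)
        omega
    · push Not at h
      obtain ⟨q, hq, hqF⟩ := h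
      exact ⟨insert q F, by rw [Finset.card_insert_of_notMem hqF, hFj], hq.trans (by omega)⟩

end Configurations

section Embedding

lemma card_image_le_card_image {J X Y : Type*} [Fintype J] [DecidableEq X] [DecidableEq Y]
    [Nonempty Y] {f : J → X} {g : J → Y} (h : ∀ j j', f j = f j' → g j = g j') :
    (Finset.univ.image g).card ≤ (Finset.univ.image f).card := by
  have hg : g = Function.extend f g (fun _ => Classical.arbitrary Y) ∘ f :=
    funext fun j => (Function.FactorsThrough.extend_apply (fun a b => h a b) _ j).symm
  rw [hg, ← Finset.image_image]
  exact Finset.card_image_le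

lemma comp_line_congr {α β ι : Type*} (L : Line α ι) {f : α → β} {a b : α} (h : f a = f b) :
    f ∘ L a = f ∘ L b := by
  ext i
  cases hi : L.idxFun i <;> simp [Line.apply_def, hi, h]

/-- A dense set spans a copy of a configuration that embeds in the group along all lines. -/
lemma exists_spanned_configuration {Γ V : Type} [Group Γ] [Finite Γ] [DecidableEq Γ]
    [AddCommGroup V] [DecidableEq V] {k : ℕ} [NeZero k] (r c : Fin k → V)
    (hrc : ∀ j j', r j = r j' → c j = c j' → j = j') {ι : Type} [Finite ι] {δ : ℝ}
    (hι : ∀ P : (ι → Fin k) → Prop, δ ≤ avg (fun x => ind (P x)) →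
      ∃ L : Line (Fin k) ι, ∀ b, P (L b))
    (Φ : Multiplicative (ι → V) →* Γ)
    (hΦr : ∀ (L : Line (Fin k) ι) j j', Φ (.ofAdd (r ∘ L j)) = Φ (.ofAdd (r ∘ L j')) → r j = r j')
    (hΦc : ∀ (L : Line (Fin k) ι) j j', Φ (.ofAdd (c ∘ L j)) = Φ (.ofAdd (c ∘ L j')) → c j = c j')
    (S : Finset (Γ × Γ)) (hS : δ ≤ avg fun q : Γ × Γ => ind (q ∈ S)) :
    ∃ T : Finset Γ, T.card ≤ (Finset.univ.image r).card + (Finset.univ.image c).card +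
      (Finset.univ.image fun j => r j + c j).card ∧ k ≤ spannedCount S T := by
  have hinv : ∀ w : ι → Fin k, avg (fun q : Γ × Γ =>
      ind ((q.1 * Φ (.ofAdd (r ∘ w)), Φ (.ofAdd (c ∘ w)) * q.2) ∈ S)) =
      avg fun q : Γ × Γ => ind (q ∈ S) := fun w =>
    avg_equiv ((Equiv.mulRight (Φ (.ofAdd (r ∘ w)))).prodCongr
      (Equiv.mulLeft (Φ (.ofAdd (c ∘ w))))) fun q => ind (q ∈ S)
  have h1 := avg_mono fun w => (hS.trans_eq (hinv w).symm)
  rw [avg_const, avg_comm] at h1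
  obtain ⟨⟨x, y⟩, hxy⟩ := exists_avg_le fun q : Γ × Γ => avg fun w : ι → Fin k =>
    ind ((q.1 * Φ (.ofAdd (r ∘ w)), Φ (.ofAdd (c ∘ w)) * q.2) ∈ S)
  obtain ⟨L, hL⟩ := hι _ (h1.trans hxy)
  let row : Fin k → Γ := fun j => x * Φ (.ofAdd (r ∘ L j))
  let col : Fin k → Γ := fun j => Φ (.ofAdd (c ∘ L j)) * y
  have hprod : ∀ j, row j * col j = x * Φ (.ofAdd ((fun j => r j + c j) ∘ L j)) * y := by
    intro j
    have : (fun j => r j + c j) ∘ L j = r ∘ L j + c ∘ L j := rfl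
    rw [this, ofAdd_add, map_mul]
    simp only [row, col, mul_assoc]
  refine ⟨Finset.univ.image row ∪ Finset.univ.image col ∪
    Finset.univ.image fun j => row j * col j, ?_, ?_⟩
  · refine (Finset.card_union_le _ _).trans (add_le_add ((Finset.card_union_le _ _).trans
      (add_le_add ?_ ?_)) ?_)
    · exact card_image_le_card_image fun j j' h => by simp only [row, comp_line_congr L h]
    · exact card_image_le_card_image fun j j' h => by simp only [col, comp_line_congr L h]
    · exact card_image_le_card_image fun j j' h => by
        simp only [hprod, comp_line_congr (f := fun j => r j + c j) L h]
  · have hinj : Function.Injective fun j => (row j, col j) := fun j j' h => by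
      rw [Prod.mk.injEq] at h
      exact hrc _ _ (hΦr L j j' (mul_left_cancel h.1)) (hΦc L j j' (mul_right_cancel h.2))
    calc k = (Finset.univ.image fun j => (row j, col j)).card := by
          rw [Finset.card_image_of_injective _ hinj, Finset.card_fin]
      _ ≤ spannedCount S _ := Finset.card_le_card fun q hq => by
          obtain ⟨j, -, rfl⟩ := Finset.mem_image.1 hq
          refine Finset.mem_filter.2 ⟨hL j, ?_, ?_, ?_⟩
          · exact Finset.mem_union_left _ (Finset.mem_union_left _
              (Finset.mem_image_of_mem _ (Finset.mem_univ j)))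
          · exact Finset.mem_union_left _ (Finset.mem_union_right _
              (Finset.mem_image_of_mem _ (Finset.mem_univ j)))
          · exact Finset.mem_union_right _ (Finset.mem_image.2 ⟨j, Finset.mem_univ j, rfl⟩)

lemma exists_configuration {V : Type*} [AddCommGroup V] [DecidableEq V] (k : ℕ)
    (hV : ∀ C : Finset V, C.card < k → ∃ c, c ∉ C) :
    ∃ r c : Fin k → V, (∀ j j', r j = r j' → c j = c j' → j = j') ∧
      (Finset.univ.image r).card + (Finset.univ.image c).card +
        (Finset.univ.image fun j => r j + c j).card ≤ k + 3 := by
  obtain ⟨F, hFk, hF⟩ := exists_supportSize_le k hV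
  let e := (F.equivFinOfCardEq hFk).symm
  have himage : ∀ f : V × V → V, (Finset.univ.image fun j => f (e j).1) = F.image f := by
    intro f
    ext v
    simp only [Finset.mem_image, Finset.mem_univ, true_and]
    constructor
    · rintro ⟨j, rfl⟩
      exact ⟨_, (e j).2, rfl⟩
    · rintro ⟨q, hq, rfl⟩
      exact ⟨e.symm ⟨q, hq⟩, by simp⟩
  refine ⟨fun j => (e j).1.1, fun j => (e j).1.2, fun j j' h1 h2 =>
    e.injective (Subtype.ext (Prod.ext h1 h2)), ?_⟩
  rw [himage fun q => q.1, himage fun q => q.2, himage fun q => q.1 + q.2]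
  exact hF

lemma eq_of_zpow_sum_line_eq {Γ α ι : Type*} [Group Γ] [Fintype ι] {h : Γ} {B : ℕ}
    (hh : Fintype.card ι * B < orderOf h) (r : α → ℤ) (L : Line α ι) {a b : α}
    (hB : (r a - r b).natAbs ≤ B)
    (hab : h ^ ∑ i, r (L a i) = h ^ ∑ i, r (L b i)) : r a = r b := by
  classical
  have h1 : ∑ i, r (L a i) - ∑ i, r (L b i) =
      (Finset.univ.filter fun i => L.idxFun i = none).card * (r a - r b) := by
    rw [← Finset.sum_sub_distrib, ← nsmul_eq_mul, ← Finset.sum_const, Finset.sum_filter]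
    refine Finset.sum_congr rfl fun i _ => ?_
    cases hi : L.idxFun i <;> simp [hi]
  have h2 : (orderOf h : ℤ) ∣
      (Finset.univ.filter fun i => L.idxFun i = none).card * (r a - r b) := by
    rw [← h1, orderOf_dvd_iff_zpow_eq_one, zpow_sub, hab, mul_inv_cancel]
  have h3 := Int.eq_zero_of_dvd_of_natAbs_lt_natAbs h2 (by
    rw [Int.natAbs_mul, Int.natAbs_natCast, Int.natAbs_natCast]
    exact (Nat.mul_le_mul (Finset.card_le_univ _) hB).trans_lt hh)
  obtain ⟨i, hi⟩ := L.proper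
  have h4 : (Finset.univ.filter fun i => L.idxFun i = none).card ≠ 0 :=
    Finset.card_ne_zero_of_mem (Finset.mem_filter.2 ⟨Finset.mem_univ i, hi⟩)
  rcases mul_eq_zero.1 h3 with h5 | h5
  · exact absurd (by exact_mod_cast h5) h4
  · exact sub_eq_zero.1 h5

end Embedding

/-- Brown–Erdős–Sós conjecture for groups. -/
theorem stmt_1 (k : ℕ) (hk : 3 ≤ k) (c : ℝ) (hc : 0 < c) :
    ∃ n₀ : ℕ, ∀ (Γ : Type) [Group Γ] [Fintype Γ] [DecidableEq Γ],
      n₀ ≤ Fintype.card Γ →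
      ∀ S : Finset (Γ × Γ), c * (Fintype.card Γ : ℝ) ^ 2 ≤ (S.card : ℝ) →
        ∃ T : Finset Γ, T.card ≤ k + 3 ∧ k ≤ spannedCount S T := by
  have : NeZero k := ⟨by omega⟩
  obtain ⟨ι, _, hι⟩ := densityHJ (Fin k) c hc
  cases nonempty_fintype ι
  obtain ⟨r, s, hrs, hsize⟩ := exists_configuration (V := ℤ) k fun C _ =>
    Infinite.exists_notMem_finset C
  obtain ⟨B, hB⟩ := Finite.exists_le fun j : Fin k × Fin k =>
    max (r j.1 - r j.2).natAbs (s j.1 - s j.2).natAbs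
  obtain ⟨n₀, hn₀⟩ := exists_orderOf_gt_or_exists_injective (Fintype.card ι * B) (ι × Fin k)
  refine ⟨n₀, fun Γ _ _ _ hΓ S hS => ?_⟩
  have hdens : c ≤ avg fun q : Γ × Γ => ind (q ∈ S) := by
    have hpos : (0 : ℝ) < Fintype.card Γ := by exact_mod_cast Fintype.card_pos
    rw [avg_eq, le_div_iff₀ (by rw [Fintype.card_prod]; push_cast; positivity), Fintype.card_prod]
    have hsum : ∑ q : Γ × Γ, ind (q ∈ S) = S.card := by
      rw [← Finset.sum_subset S.subset_univ fun q _ hq => ind_of_false hq,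
        Finset.sum_congr rfl fun q hq => ind_of_true hq]
      simp
    simpa [hsum, sq] using hS
  rcases hn₀ Γ (by rwa [Nat.card_eq_fintype_card]) with ⟨h, hh⟩ | ⟨p, hp, Φ, hΦ⟩
  · let Φ : Multiplicative (ι → ℤ) →* Γ :=
      { toFun := fun f => h ^ ∑ i, f.toAdd i
        map_one' := by simp
        map_mul' := fun f g => by simp [Finset.sum_add_distrib, zpow_add] }
    obtain ⟨T, hT, hTS⟩ := exists_spanned_configuration r s hrs hι Φ
      (fun L j j' => eq_of_zpow_sum_line_eq hh r L ((le_max_left _ _).trans (hB (j, j'))))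
      (fun L j j' => eq_of_zpow_sum_line_eq hh s L ((le_max_right _ _).trans (hB (j, j')))) S hdens
    exact ⟨T, hT.trans hsize, hTS⟩
  · have : Fact p.Prime := ⟨hp⟩
    obtain ⟨r, s, hrs, hsize⟩ := exists_configuration (V := Fin k → ZMod p) k fun C hC => by
      by_contra! hall
      rw [Finset.eq_univ_iff_forall.2 hall, Finset.card_univ, Fintype.card_fun, ZMod.card,
        Fintype.card_fin] at hC
      exact hC.not_gt (Nat.lt_pow_self hp.one_lt)
    let Ψ : (ι → Fin k → ZMod p) →+ (ι × Fin k → ZMod p) :=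
      { toFun := fun f q => f q.1 q.2
        map_zero' := rfl
        map_add' := fun _ _ => rfl }
    have hsep : ∀ (f : Fin k → Fin k → ZMod p) (L : Line (Fin k) ι) j j',
        Φ.comp Ψ.toMultiplicative (.ofAdd (f ∘ L j)) =
          Φ.comp Ψ.toMultiplicative (.ofAdd (f ∘ L j')) → f j = f j' := by
      intro f L j j' hjj
      obtain ⟨i, hi⟩ := L.proper
      ext e
      have := congrFun (Multiplicative.ofAdd.injective (hΦ hjj)) (i, e)
      simpa [Ψ, Line.apply_none, hi] using this
    obtain ⟨T, hT, hTS⟩ := exists_spanned_configuration r s hrs hι (Φ.comp Ψ.toMultiplicative)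
      (hsep r) (hsep s) S hdens
    exact ⟨T, hT.trans hsize, hTS⟩
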